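/- arXiv:2510.07744 — 2 statements merged into one kernel-verified Lean document; each statement's English description precedes it below -/
import Mathlib

section
/- Let S = stack(P,Q) ∈ SYT^stacked(2r×c) where P, Q ∈ SYT(r×c) and n = rc, and let ρ_r := prom_r(S) ∈ S_{2n}. Then Viennot's construction applied with light shining to the northeast to the point set 𝒫^NE(ρ_r) ⊂ [n]×[n] yields 𝒱(𝒫^NE(ρ_r), ↗) = (∂(P), Q), where ∂ denotes evacuation. -/
namespace PromRS

/-! ## Rectangular standard Young tableaux (as functions; 0-indexed cells; entries 1..R*C) -/

/-- `T` is a standard Young tableau of rectangular shape with `R` rows and `C` columns: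
rows and columns strictly increase, and the entries on the `R × C` rectangle are a
bijection onto `{1, …, R*C}`. -/
def IsSYT (R C : ℕ) (T : ℕ → ℕ → ℕ) : Prop :=
  (∀ i j, i < R → j + 1 < C → T i j < T i (j + 1)) ∧
  (∀ i j, i + 1 < R → j < C → T i j < T (i + 1) j) ∧
  Set.BijOn (fun p : ℕ × ℕ => T p.1 p.2) {p : ℕ × ℕ | p.1 < R ∧ p.2 < C} (Set.Icc 1 (R * C))

/-- Stacking: add `r*c` to every entry of `Q` and place the result below `P`. -/
def stack (r c : ℕ) (P Q : ℕ → ℕ → ℕ) : ℕ → ℕ → ℕ := fun i j =>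
  if i < r then P i j else Q (i - r) j + r * c

/-! ## Gromotion and promotion permutations -/

/-- Value of `T` at a cell, with `⊤` outside the `R × C` rectangle. -/
def ext (R C : ℕ) (T : ℕ → ℕ → ℕ) (p : ℕ × ℕ) : WithTop ℕ :=
  if p.1 < R ∧ p.2 < C then ((T p.1 p.2 : ℕ) : WithTop ℕ) else ⊤

/-- The jeu de taquin slide moves the empty cell to the smaller of its east/south neighbors. -/
def nextCell (R C : ℕ) (T : ℕ → ℕ → ℕ) (p : ℕ × ℕ) : ℕ × ℕ :=
  if ext R C T (p.1, p.2 + 1) < ext R C T (p.1 + 1, p.2) then (p.1, p.2 + 1)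
  else (p.1 + 1, p.2)

/-- The sliding path of the empty cell, starting at the top-left corner. -/
def slidePath (R C : ℕ) (T : ℕ → ℕ → ℕ) : ℕ → ℕ × ℕ
  | 0 => (0, 0)
  | k + 1 => nextCell R C T (slidePath R C T k)

def maxEntry (R C : ℕ) (T : ℕ → ℕ → ℕ) : ℕ :=
  ((Finset.range R) ×ˢ (Finset.range C)).sup fun p => T p.1 p.2

/-- Gromotion: delete the minimal entry (at the top-left corner), rectify by jeu de taquin
slides, and fill the vacated outer corner with (current maximum) + 1; entries are not
decremented. -/
def gromotion (R C : ℕ) (T : ℕ → ℕ → ℕ) : ℕ → ℕ → ℕ := fun i j =>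
  if i = R - 1 ∧ j = C - 1 then maxEntry R C T + 1
  else
    match (List.range (R + C - 2)).find? (fun k => decide (slidePath R C T k = (i, j))) with
    | some k => T (slidePath R C T (k + 1)).1 (slidePath R C T (k + 1)).2
    | none => T i j

/-- The entry that slides (up) into row `i` (1-indexed) during one gromotion slide of `T`:
the value of `T` at the first cell of the sliding path lying in 0-indexed row `i`. -/
def slideInto (R C : ℕ) (T : ℕ → ℕ → ℕ) (i : ℕ) : ℕ :=
  match (List.range (R + C - 1)).find? (fun k => decide ((slidePath R C T k).1 = i)) with
  | some k => T (slidePath R C T k).1 (slidePath R C T k).2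
  | none => 0

/-- The `i`-th promotion permutation of `T ∈ SYT(R × C)`: its value at `j` is the entry
that slides into row `i` when computing `gromotion^j(T)`, taken modulo `R*C` with
residues in `{1, …, R*C}`. -/
def promPerm (R C : ℕ) (T : ℕ → ℕ → ℕ) (i : ℕ) : ℕ → ℕ := fun j =>
  (slideInto R C ((gromotion R C)^[j - 1] T) i - 1) % (R * C) + 1

/-! ## Tableaux as lists of rows, Robinson–Schensted insertion -/

/-- Entry of a list-of-rows tableau (0-indexed; `0` outside). -/
def entryL (T : List (List ℕ)) (i j : ℕ) : ℕ := (T.getD i []).getD j 0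

/-- Convert a function tableau on an `R × C` rectangle to a list of rows. -/
def toListT (R C : ℕ) (T : ℕ → ℕ → ℕ) : List (List ℕ) :=
  (List.range R).map fun i => (List.range C).map fun j => T i j

/-- Transpose (conjugate) of a list-of-rows tableau. -/
def transposeT (T : List (List ℕ)) : List (List ℕ) :=
  (List.range (T.getD 0 []).length).map fun j => T.filterMap fun row => row[j]?

/-- Shape (row lengths) of a list-of-rows tableau. -/
def shapeL (T : List (List ℕ)) : List ℕ := T.map List.length

/-- Standard Young tableau, as a list of rows: weakly decreasing nonempty row lengths,
rows and columns strictly increasing, and entries exactly `{1, …, N}` where `N` is the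
number of cells. -/
def IsSYTList (T : List (List ℕ)) : Prop :=
  (∀ i, i + 1 < T.length → (T.getD (i + 1) []).length ≤ (T.getD i []).length) ∧
  (∀ row ∈ T, row ≠ []) ∧
  (∀ i j, i < T.length → j + 1 < (T.getD i []).length → entryL T i j < entryL T i (j + 1)) ∧
  (∀ i j, i + 1 < T.length → j < (T.getD (i + 1) []).length →
    entryL T i j < entryL T (i + 1) j) ∧
  T.flatten.Nodup ∧ (∀ m, m ∈ T.flatten ↔ 1 ≤ m ∧ m ≤ T.flatten.length)

/-- Schensted row insertion of `x` into a tableau. -/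
def rowInsert : List (List ℕ) → ℕ → List (List ℕ)
  | [], x => [[x]]
  | r :: rs, x =>
    match r.dropWhile (fun y => decide (y < x)) with
    | [] => (r ++ [x]) :: rs
    | y :: bs => (r.takeWhile (fun y => decide (y < x)) ++ x :: bs) :: rowInsert rs y

/-- The (0-indexed) row where the shape grew when passing from `P` to `P'`. -/
def rowOfNewCell (P P' : List (List ℕ)) : ℕ :=
  ((List.range P'.length).find? fun i =>
    decide ((P'.getD i []).length ≠ (P.getD i []).length)).getD 0

def placeInRow (Q : List (List ℕ)) (r k : ℕ) : List (List ℕ) :=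
  if r < Q.length then Q.set r (Q.getD r [] ++ [k]) else Q ++ [[k]]

/-- The Robinson–Schensted correspondence: the pair (insertion tableau, recording tableau)
of a word. -/
def RS (w : List ℕ) : List (List ℕ) × List (List ℕ) :=
  (List.range w.length).foldl
    (fun PQ i =>
      let P' := rowInsert PQ.1 (w.getD i 0)
      (P', placeInRow PQ.2 (rowOfNewCell PQ.1 P') (i + 1)))
    ([], [])

/-! ## Jeu de taquin on list tableaux; evacuation -/

def extL (T : List (List ℕ)) (p : ℕ × ℕ) : WithTop ℕ :=
  if p.2 < (T.getD p.1 []).length then ((entryL T p.1 p.2 : ℕ) : WithTop ℕ) else ⊤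

def nextCellL (T : List (List ℕ)) (p : ℕ × ℕ) : ℕ × ℕ :=
  if extL T (p.1, p.2 + 1) = ⊤ ∧ extL T (p.1 + 1, p.2) = ⊤ then p
  else if extL T (p.1, p.2 + 1) < extL T (p.1 + 1, p.2) then (p.1, p.2 + 1)
  else (p.1 + 1, p.2)

def jdtPath (T : List (List ℕ)) : ℕ → ℕ × ℕ
  | 0 => (0, 0)
  | k + 1 => nextCellL T (jdtPath T k)

/-- The outer corner vacated when the minimal entry of `T` is deleted and the tableau is
rectified by jeu de taquin slides. -/
def vacated (T : List (List ℕ)) : ℕ × ℕ := jdtPath T T.flatten.length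

/-- The value at cell `(i, j)` after the rectification slide. -/
def slidValue (T : List (List ℕ)) (i j : ℕ) : ℕ :=
  match (List.range T.flatten.length).find? (fun k =>
      decide (jdtPath T k = (i, j) ∧ jdtPath T (k + 1) ≠ (i, j))) with
  | some k => entryL T (jdtPath T (k + 1)).1 (jdtPath T (k + 1)).2
  | none => entryL T i j

/-- Delete the minimal entry of `T` and rectify. -/
def delta (T : List (List ℕ)) : List (List ℕ) :=
  ((List.range T.length).map fun i =>
    (List.range ((T.getD i []).length - if i = (vacated T).1 then 1 else 0)).map fun j =>
      slidValue T i j).filter fun row => decide (row ≠ [])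

/-- The entry of the evacuation `∂T` at cell `(i,j)`: `n + 1 - k` where the `k`-th
deletion-rectification vacates `(i,j)`. -/
def evacEntry (T : List (List ℕ)) (i j : ℕ) : ℕ :=
  match (List.range T.flatten.length).find? (fun k =>
      decide (vacated (delta^[k] T) = (i, j))) with
  | some k => T.flatten.length - k
  | none => 0

/-- Schützenberger evacuation `∂T` of a standard Young tableau. -/
def evacL (T : List (List ℕ)) : List (List ℕ) :=
  (List.range T.length).map fun i =>
    (List.range (T.getD i []).length).map fun j => evacEntry T i j

/-! ## Shadow lines, skeleta, and Viennot's construction -/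

def dirNE (a b : ℤ × ℤ) : Prop := a.1 ≤ b.1 ∧ a.2 ≤ b.2
def dirSE (a b : ℤ × ℤ) : Prop := a.1 ≤ b.1 ∧ b.2 ≤ a.2
def dirSW (a b : ℤ × ℤ) : Prop := b.1 ≤ a.1 ∧ b.2 ≤ a.2
def dirNW (a b : ℤ × ℤ) : Prop := b.1 ≤ a.1 ∧ a.2 ≤ b.2

def minimalsUnder (d : ℤ × ℤ → ℤ × ℤ → Prop) (P : Set (ℤ × ℤ)) : Set (ℤ × ℤ) :=
  {p ∈ P | ∀ q ∈ P, d q p → q = p}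

/-- `P` minus its first `j` shadow lines. -/
def shadowRest (d : ℤ × ℤ → ℤ × ℤ → Prop) (P : Set (ℤ × ℤ)) : ℕ → Set (ℤ × ℤ)
  | 0 => P
  | j + 1 => shadowRest d P j \ minimalsUnder d (shadowRest d P j)

/-- The `j`-th shadow line of `P` (1-indexed `j`). -/
def shadowLine (d : ℤ × ℤ → ℤ × ℤ → Prop) (P : Set (ℤ × ℤ)) (j : ℕ) : Set (ℤ × ℤ) :=
  minimalsUnder d (shadowRest d P (j - 1))

/-- The skeleton of a single shadow line `L`: the minimal elements of the set of points
covered by the shadows of at least two points of `L`. -/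
def lineSkeleton (d : ℤ × ℤ → ℤ × ℤ → Prop) (L : Set (ℤ × ℤ)) : Set (ℤ × ℤ) :=
  minimalsUnder d {x | ∃ p ∈ L, ∃ q ∈ L, p ≠ q ∧ d p x ∧ d q x}

/-- The skeleton of `P`: the union of the skeleta of its shadow lines. -/
def skeleton (d : ℤ × ℤ → ℤ × ℤ → Prop) (P : Set (ℤ × ℤ)) : Set (ℤ × ℤ) :=
  ⋃ j : ℕ, lineSkeleton d (shadowLine d P (j + 1))

/-- The `k`-th iterated skeleton of `P`. -/
def skeletonIter (d : ℤ × ℤ → ℤ × ℤ → Prop) (P : Set (ℤ × ℤ)) (k : ℕ) : Set (ℤ × ℤ) :=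
  (skeleton d)^[k] P

def IsMinSnd (L : Set (ℤ × ℤ)) (y : ℤ) : Prop := (∃ p ∈ L, p.2 = y) ∧ ∀ p ∈ L, y ≤ p.2
def IsMaxSnd (L : Set (ℤ × ℤ)) (y : ℤ) : Prop := (∃ p ∈ L, p.2 = y) ∧ ∀ p ∈ L, p.2 ≤ y
def IsMinFst (L : Set (ℤ × ℤ)) (x : ℤ) : Prop := (∃ p ∈ L, p.1 = x) ∧ ∀ p ∈ L, x ≤ p.1
def IsMaxFst (L : Set (ℤ × ℤ)) (x : ℤ) : Prop := (∃ p ∈ L, p.1 = x) ∧ ∀ p ∈ L, p.1 ≤ x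

/-- The set of exit coordinates (specified by `spec`) of the shadow lines of the `i`-th
iterated skeleton of `P` in direction `d`. -/
def exitSet (spec : Set (ℤ × ℤ) → ℤ → Prop) (d : ℤ × ℤ → ℤ × ℤ → Prop)
    (P : Set (ℤ × ℤ)) (i : ℕ) : Set ℤ :=
  {v | ∃ j : ℕ, spec (shadowLine d (skeletonIter d P i) (j + 1)) v}

/-- The word read off along one edge in Viennot's construction is the lattice word of the
standard tableau `T`: there is an enumeration `e` of all shadow-line exit coordinates,
in the order prescribed by `lt`, such that the `m`-th exit belongs to a shadow line of the
`i`-th iterated skeleton exactly when the entry `m` of `T` lies in row `i + 1`. -/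
def ReadsWord (spec : Set (ℤ × ℤ) → ℤ → Prop) (lt : ℤ → ℤ → Prop)
    (d : ℤ × ℤ → ℤ × ℤ → Prop) (P : Set (ℤ × ℤ)) (T : List (List ℕ)) : Prop :=
  ∃ e : Fin T.flatten.length → ℤ,
    (∀ a b : Fin T.flatten.length, a < b → lt (e a) (e b)) ∧
    (Set.range e = ⋃ i : ℕ, exitSet spec d P i) ∧
    ∀ (m : Fin T.flatten.length) (i : ℕ), e m ∈ exitSet spec d P i →
      (T.findIdx fun row => row.contains (m.1 + 1)) + 1 = i + 1

/-- `𝒱(𝒫, ↗) = (Pt, Qt)`: the P-word is read bottom-to-top along the right edge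
(east exit heights, which are the minimal `y`-coordinates of the lines), the Q-word
left-to-right along the top edge (north exits at minimal `x`-coordinates). -/
def ViennotNE (P : Set (ℤ × ℤ)) (Pt Qt : List (List ℕ)) : Prop :=
  ReadsWord IsMinSnd (· < ·) dirNE P Pt ∧ ReadsWord IsMinFst (· < ·) dirNE P Qt

/-- `𝒱(𝒫, ↘) = (Pt, Qt)`: P-word left-to-right along the bottom edge, Q-word
top-to-bottom along the right edge. -/
def ViennotSE (P : Set (ℤ × ℤ)) (Pt Qt : List (List ℕ)) : Prop :=
  ReadsWord IsMinFst (· < ·) dirSE P Pt ∧ ReadsWord IsMaxSnd (· > ·) dirSE P Qt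

/-- `𝒱(𝒫, ↙) = (Pt, Qt)`: P-word bottom-to-top along the left edge, Q-word
right-to-left along the bottom edge. -/
def ViennotSW (P : Set (ℤ × ℤ)) (Pt Qt : List (List ℕ)) : Prop :=
  ReadsWord IsMaxSnd (· < ·) dirSW P Pt ∧ ReadsWord IsMaxFst (· > ·) dirSW P Qt

/-- `𝒱(𝒫, ↖) = (Pt, Qt)`: P-word right-to-left along the top edge, Q-word
bottom-to-top along the left edge. -/
def ViennotNW (P : Set (ℤ × ℤ)) (Pt Qt : List (List ℕ)) : Prop :=
  ReadsWord IsMaxFst (· > ·) dirNW P Pt ∧ ReadsWord IsMinSnd (· < ·) dirNW P Qt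

/-- The point set `𝒫^NE(ρ)` of the northeast `n × n` block of the permutation matrix of
`ρ ∈ S_{2n}`, in Cartesian coordinates. -/
def pointsNE (n : ℕ) (f : ℕ → ℕ) : Set (ℤ × ℤ) :=
  {p | ∃ x : ℕ, 1 ≤ x ∧ x ≤ n ∧ n < f x ∧ p = ((f x : ℤ) - n, (n : ℤ) + 1 - x)}

/-! ## Crossings and nestings of perfect matchings -/

/-- The matching `{a, f a}` on `{1, …, N}` has a `k`-crossing:
blocks `{a₁ < b₁}, …, {a_k < b_k}` with `a₁ < ⋯ < a_k < b₁ < ⋯ < b_k`. -/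
def HasCrossing (f : ℕ → ℕ) (N k : ℕ) : Prop :=
  ∃ a b : Fin k → ℕ, StrictMono a ∧ StrictMono b ∧
    (∀ m, 1 ≤ a m ∧ b m ≤ N ∧ f (a m) = b m ∧ a m < b m) ∧
    ∀ m m' : Fin k, a m < b m'

/-- The matching `{a, f a}` on `{1, …, N}` has a `k`-nesting:
blocks `{a₁ < b₁}, …, {a_k < b_k}` with `a₁ < ⋯ < a_k < b_k < ⋯ < b₁`. -/
def HasNesting (f : ℕ → ℕ) (N k : ℕ) : Prop :=
  ∃ a b : Fin k → ℕ, StrictMono a ∧ StrictAnti b ∧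
    (∀ m, 1 ≤ a m ∧ b m ≤ N ∧ f (a m) = b m ∧ a m < b m) ∧
    ∀ m m' : Fin k, a m < b m'

/-! ## Local rules, the promotion–evacuation diagram, and the promotion matrix -/

/-- Partitions are encoded as lists of row lengths (fixed length, padded by zeros). -/
def sortDesc (l : List ℕ) : List ℕ := List.insertionSort (· ≥ ·) l

/-- The sequence `ν + κ - λ` (pointwise). -/
def ruleSeq (lam nu ka : List ℕ) : List ℕ :=
  List.zipWith (fun a b => a - b) (List.zipWith (· + ·) nu ka) lam

/-- The local rule: `μ = sort(ν + κ - λ)`. -/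
def localRule (lam nu ka : List ℕ) : List ℕ := sortDesc (ruleSeq lam nu ka)

/-- The decoration of a local rule square: `i` if `ν + κ - λ` fails to be sorted at rows
`i, i+1` (1-indexed), and `0` if no decoration is present. -/
def decoration (lam nu ka : List ℕ) : ℕ :=
  match (List.range (ruleSeq lam nu ka).length).find? (fun i =>
      decide ((ruleSeq lam nu ka).getD i 0 < (ruleSeq lam nu ka).getD (i + 1) 0)) with
  | some i => i + 1
  | none => 0

/-- Fill in the next row of the promotion–evacuation diagram from the previous row `prev`:
the new row starts with the empty partition at position `s` and continues by local rules. -/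
def nextRow (R : ℕ) (prev : ℕ → List ℕ) (s : ℕ) : ℕ → List ℕ
  | 0 => List.replicate R 0
  | x + 1 =>
    if x + 1 ≤ s then List.replicate R 0
    else localRule (prev x) (prev (x + 1)) (nextRow R prev s x)

/-- The `j`-th row of the promotion–evacuation diagram of `T ∈ SYT(R × C)`, as a function
of the column index (row `0` is the chain of `T`). -/
def PErow (R C : ℕ) (T : ℕ → ℕ → ℕ) : ℕ → ℕ → List ℕ
  | 0 => fun x => (List.range R).map fun i =>
      ((Finset.range C).filter fun j => T i j ≤ min x (R * C)).card
  | j + 1 => nextRow R (PErow R C T j) (j + 1)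

/-- For `S = stack(P, Q) ∈ SYT(2r × c)` and `n = r*c`, the `(n+1) × (n+1)` northeast block
of partitions `λ(x, y)` of `PEdiagram(S)` (Cartesian coordinates): `λ(x,y)` is the
diagram entry in row `n - y`, column `n + x`. -/
def lamBlock (r c : ℕ) (S : ℕ → ℕ → ℕ) (x y : ℕ) : List ℕ :=
  PErow (2 * r) c S (r * c - y) (r * c + x)

/-- The entry of `PM(S)^NE` at Cartesian coordinates `(x, y)`, `1 ≤ x, y ≤ n`: the
decoration of the local rule square with corners `λ(x-1, y-1)`, `λ(x-1, y)`, `λ(x, y-1)`,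
`λ(x, y)`. -/
def PMNE (r c : ℕ) (S : ℕ → ℕ → ℕ) (x y : ℕ) : ℕ :=
  decoration (lamBlock r c S (x - 1) y) (lamBlock r c S x y) (lamBlock r c S (x - 1) (y - 1))

/-- Chain of partitions of a list tableau: shape of the entries `≤ m`. -/
def chainOfL (T : List (List ℕ)) (m : ℕ) : List ℕ :=
  T.map fun row => (row.filter fun a => decide (a ≤ m)).length

/-- Column height `#{i : j < l i}` of a partition. -/
def colHeight (l : List ℕ) (j : ℕ) : ℕ := (l.filter fun a => decide (j < a)).length

/-- Vertical sum `l +' m` of two partitions (stack the columns of `m` onto those of `l`),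
computed inside a `rows × cols` bounding box. -/
def vsum (rows cols : ℕ) (l m : List ℕ) : List ℕ :=
  (List.range rows).map fun i =>
    ((List.range cols).filter fun j => decide (i < colHeight l j + colHeight m j)).length

/-! ## The point sets `S_k` and `S_{kj}` -/

/-- `x_{sj}`: the entry of `Q` in row `s`, column `j` (1-indexed). -/
def xEnt (Q : ℕ → ℕ → ℕ) (s j : ℕ) : ℤ := (Q (s - 1) (j - 1) : ℤ)

/-- `y_{tj}`: the entry of `∂(P)` in row `t`, column `j` (1-indexed). -/
def yEnt (r c : ℕ) (P : ℕ → ℕ → ℕ) (t j : ℕ) : ℤ :=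
  (entryL (evacL (toListT r c P)) (t - 1) (j - 1) : ℤ)

def Skj (r c : ℕ) (P Q : ℕ → ℕ → ℕ) (k j : ℕ) : Set (ℤ × ℤ) :=
  {p | ∃ s t : ℕ, 1 ≤ s ∧ s ≤ r ∧ 1 ≤ t ∧ t ≤ r ∧ s + t - 1 = k ∧
    p = (xEnt Q s j, yEnt r c P t j)}

def Sk (r c : ℕ) (P Q : ℕ → ℕ → ℕ) (k : ℕ) : Set (ℤ × ℤ) :=
  ⋃ j ∈ Set.Icc 1 c, Skj r c P Q k j

/-- A southeast chain of `k` ones in the matrix `U` (rows increase, columns increase),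
contained in a rectangle that fully fits into the strictly upper triangular part of the
`N × N` matrix. -/
def HasSEChain (U : ℕ → ℕ → ℕ) (N k : ℕ) : Prop :=
  ∃ a b : Fin k → ℕ, StrictMono a ∧ StrictMono b ∧ (∀ m, U (a m) (b m) = 1) ∧
    ∃ r₁ r₂ c₁ c₂ : ℕ, 1 ≤ r₁ ∧ r₂ < c₁ ∧ c₂ ≤ N ∧
      ∀ m, r₁ ≤ a m ∧ a m ≤ r₂ ∧ c₁ ≤ b m ∧ b m ≤ c₂

/-- A southwest chain of `k` ones in the matrix `U` (rows increase, columns decrease),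
contained in a rectangle that fully fits into the strictly upper triangular part of the
`N × N` matrix. -/
def HasSWChain (U : ℕ → ℕ → ℕ) (N k : ℕ) : Prop :=
  ∃ a b : Fin k → ℕ, StrictMono a ∧ StrictAnti b ∧ (∀ m, U (a m) (b m) = 1) ∧
    ∃ r₁ r₂ c₁ c₂ : ℕ, 1 ≤ r₁ ∧ r₂ < c₁ ∧ c₂ ≤ N ∧
      ∀ m, r₁ ≤ a m ∧ a m ≤ r₂ ∧ c₁ ≤ b m ∧ b m ≤ c₂

section Tableaux

variable {R C : ℕ} {T : ℕ → ℕ → ℕ}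

theorem IsSYT.row_lt (hT : IsSYT R C T) {i j j' : ℕ} (hi : i < R) (h : j < j') (hj : j' < C) :
    T i j < T i j' := by
  induction j', h using Nat.le_induction with
  | base => exact hT.1 i j hi hj
  | succ m _ ih => exact (ih (by omega)).trans (hT.1 i m hi hj)

theorem IsSYT.col_lt (hT : IsSYT R C T) {i i' j : ℕ} (h : i < i') (hi : i' < R) (hj : j < C) :
    T i j < T i' j := by
  induction i', h using Nat.le_induction with
  | base => exact hT.2.1 i j hi hj
  | succ m _ ih => exact (ih (by omega)).trans (hT.2.1 m j hi hj)

theorem IsSYT.row_le (hT : IsSYT R C T) {i j j' : ℕ} (hi : i < R) (h : j ≤ j') (hj : j' < C) :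
    T i j ≤ T i j' := by
  rcases h.eq_or_lt with rfl | h
  · exact le_rfl
  · exact (hT.row_lt hi h hj).le

theorem IsSYT.col_le (hT : IsSYT R C T) {i i' j : ℕ} (h : i ≤ i') (hi : i' < R) (hj : j < C) :
    T i j ≤ T i' j := by
  rcases h.eq_or_lt with rfl | h
  · exact le_rfl
  · exact (hT.col_lt h hi hj).le

theorem IsSYT.inj (hT : IsSYT R C T) {i j i' j' : ℕ} (hi : i < R) (hj : j < C) (hi' : i' < R)
    (hj' : j' < C) (h : T i j = T i' j') : i = i' ∧ j = j' := by
  have := hT.2.2.injOn (show (i, j) ∈ _ from ⟨hi, hj⟩) (show (i', j') ∈ _ from ⟨hi', hj'⟩) h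
  simpa using this

theorem IsSYT.mem_Icc (hT : IsSYT R C T) {i j : ℕ} (hi : i < R) (hj : j < C) :
    1 ≤ T i j ∧ T i j ≤ R * C :=
  hT.2.2.mapsTo (show (i, j) ∈ _ from ⟨hi, hj⟩)

theorem IsSYT.exists_eq (hT : IsSYT R C T) {m : ℕ} (h1 : 1 ≤ m) (h2 : m ≤ R * C) :
    ∃ i j, i < R ∧ j < C ∧ T i j = m := by
  obtain ⟨⟨i, j⟩, ⟨hi, hj⟩, h⟩ := hT.2.2.surjOn (Set.mem_Icc.2 ⟨h1, h2⟩)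
  exact ⟨i, j, hi, hj, h⟩

theorem length_flatten_toListT (R C : ℕ) (T : ℕ → ℕ → ℕ) :
    (toListT R C T).flatten.length = R * C := by
  simp [toListT, List.length_flatten, Function.comp_def]

theorem findIdx_toListT (hT : IsSYT R C T) {i j : ℕ} (hi : i < R) (hj : j < C) :
    ((toListT R C T).findIdx fun row => row.contains (T i j)) = i := by
  have hlen : i < (toListT R C T).length := by simpa [toListT] using hi
  rw [List.findIdx_eq hlen]
  constructor
  · simp only [toListT, List.getElem_map, List.getElem_range, List.contains_eq_mem,
      List.mem_map, List.mem_range, decide_eq_true_eq]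
    exact ⟨j, hj, rfl⟩
  · intro k hk
    simp only [toListT, List.getElem_map, List.getElem_range, List.contains_eq_mem,
      List.mem_map, List.mem_range, decide_eq_false_iff_not, not_exists, not_and]
    intro j' hj' h
    have := (hT.inj (hk.trans hi) hj' hi hj h).1
    omega

end Tableaux

section Viennot

variable {r c : ℕ} {A B : ℕ → ℕ → ℕ}

/-- The points `(A s d, B t d)` with `s + t = k`, in the columns `d ≥ j`. -/
def diagFrom (r c : ℕ) (A B : ℕ → ℕ → ℕ) (k j : ℕ) : Set (ℤ × ℤ) :=
  {p | ∃ s t d, s < r ∧ t < r ∧ d < c ∧ j ≤ d ∧ s + t = k ∧ p = ((A s d : ℤ), (B t d : ℤ))}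

/-- The points `(A s d, B t d)` with `s + t = k`, in column `d`. -/
def diagCol (r c : ℕ) (A B : ℕ → ℕ → ℕ) (k d : ℕ) : Set (ℤ × ℤ) :=
  {p | ∃ s t, s < r ∧ t < r ∧ d < c ∧ s + t = k ∧ p = ((A s d : ℤ), (B t d : ℤ))}

theorem minimalsUnder_diagFrom (hA : IsSYT r c A) (hB : IsSYT r c B) (k j : ℕ) :
    minimalsUnder dirNE (diagFrom r c A B k j) = diagCol r c A B k j := by
  apply Set.eq_of_subset_of_subset
  · rintro _ ⟨⟨s, t, d, hs, ht, hd, hj, hk, rfl⟩, hmin⟩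
    have hjc : j < c := by omega
    have := hmin (A s j, B t j) ⟨s, t, j, hs, ht, hjc, le_rfl, hk, rfl⟩
      ⟨Nat.cast_le.2 (hA.row_le hs hj hd), Nat.cast_le.2 (hB.row_le ht hj hd)⟩
    exact ⟨s, t, hs, ht, hjc, hk, this.symm⟩
  · rintro _ ⟨s, t, hs, ht, hd, hk, rfl⟩
    refine ⟨⟨s, t, j, hs, ht, hd, le_rfl, hk, rfl⟩, ?_⟩
    rintro _ ⟨s', t', d', hs', ht', hd', hj', hk', rfl⟩ ⟨h1, h2⟩
    simp only [Nat.cast_le] at h1 h2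
    have hss : s' ≤ s := by
      by_contra! h
      have := hA.col_lt h hs' hd
      have := hA.row_le hs' hj' hd'
      omega
    have htt : t' ≤ t := by
      by_contra! h
      have := hB.col_lt h ht' hd
      have := hB.row_le ht' hj' hd'
      omega
    obtain rfl : s' = s := by omega
    obtain rfl : t' = t := by omega
    obtain rfl : d' = j := by
      by_contra h
      have := hA.row_lt hs (show j < d' by omega) hd'
      omega
    rfl

theorem shadowRest_diagFrom (hA : IsSYT r c A) (hB : IsSYT r c B) (k j : ℕ) :
    shadowRest dirNE (diagFrom r c A B k 0) j = diagFrom r c A B k j := by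
  induction j with
  | zero => rfl
  | succ j ih =>
    rw [shadowRest, ih, minimalsUnder_diagFrom hA hB]
    apply Set.eq_of_subset_of_subset
    · rintro _ ⟨⟨s, t, d, hs, ht, hd, hj, hk, rfl⟩, hn⟩
      refine ⟨s, t, d, hs, ht, hd, ?_, hk, rfl⟩
      by_contra h
      obtain rfl : d = j := by omega
      exact hn ⟨s, t, hs, ht, hd, hk, rfl⟩
    · rintro _ ⟨s, t, d, hs, ht, hd, hj, hk, rfl⟩
      refine ⟨⟨s, t, d, hs, ht, hd, by omega, hk, rfl⟩, ?_⟩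
      rintro ⟨s', t', hs', ht', hd', hk', h⟩
      simp only [Prod.mk.injEq, Nat.cast_inj] at h
      have := (hA.inj hs hd hs' hd' h.1).2
      omega

theorem shadowLine_diagFrom (hA : IsSYT r c A) (hB : IsSYT r c B) (k j : ℕ) :
    shadowLine dirNE (diagFrom r c A B k 0) (j + 1) = diagCol r c A B k j := by
  rw [shadowLine, shadowRest_diagFrom hA hB, minimalsUnder_diagFrom hA hB]
  simp

theorem lineSkeleton_diagCol (hA : IsSYT r c A) (hB : IsSYT r c B) {k : ℕ} (hr : r ≤ k + 1)
    (d : ℕ) :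
    lineSkeleton dirNE (diagCol r c A B k d) = diagCol r c A B (k + 1) d := by
  have key : ∀ x : ℤ × ℤ, (∃ p ∈ diagCol r c A B k d, ∃ q ∈ diagCol r c A B k d,
      p ≠ q ∧ dirNE p x ∧ dirNE q x) ↔ ∃ q ∈ diagCol r c A B (k + 1) d, dirNE q x := by
    rintro ⟨x, y⟩
    constructor
    · have aux : ∀ s t s' t', s < r → t < r → s' < r → t' < r → d < c → s + t = k →
          s' + t' = k → s < s' → (A s' d : ℤ) ≤ x → (B t d : ℤ) ≤ y →
          ∃ q ∈ diagCol r c A B (k + 1) d, dirNE q (x, y) := by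
        intro s t s' t' hs ht hs' ht' hd hk hk' hlt hx hy
        refine ⟨_, ⟨s + 1, t, by omega, ht, hd, by omega, rfl⟩, ?_, hy⟩
        have := hA.col_le (show s + 1 ≤ s' by omega) hs' hd
        simp only
        omega
      rintro ⟨_, ⟨s, t, hs, ht, hd, hk, rfl⟩, _, ⟨s', t', hs', ht', -, hk', rfl⟩, hne, hp, hq⟩
      rcases lt_trichotomy s s' with h | h | h
      · exact aux s t s' t' hs ht hs' ht' hd hk hk' h hq.1 hp.2
      · obtain rfl := h
        obtain rfl : t = t' := by omega
        exact absurd rfl hne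
      · exact aux s' t' s t hs' ht' hs ht hd hk' hk h hp.1 hq.2
    · rintro ⟨_, ⟨s, t, hs, ht, hd, hk, rfl⟩, hx, hy⟩
      simp only at hx hy
      have h1 := hA.col_lt (show s - 1 < s by omega) hs hd
      have h2 := hB.col_lt (show t - 1 < t by omega) ht hd
      refine ⟨_, ⟨s - 1, t, by omega, ht, hd, by omega, rfl⟩,
        _, ⟨s, t - 1, hs, by omega, hd, by omega, rfl⟩, ?_, ⟨?_, hy⟩, ⟨hx, ?_⟩⟩
      · simp only [ne_eq, Prod.mk.injEq, Nat.cast_inj]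
        omega
      · simp only
        omega
      · simp only
        omega
  rw [lineSkeleton]
  apply Set.eq_of_subset_of_subset
  · rintro x ⟨hx, hmin⟩
    obtain ⟨q, hq, hqx⟩ := (key x).1 hx
    exact hmin q ((key q).2 ⟨q, hq, le_rfl, le_rfl⟩) hqx ▸ hq
  · rintro x hx
    refine ⟨(key x).2 ⟨x, hx, le_rfl, le_rfl⟩, ?_⟩
    intro y hy hyx
    obtain ⟨z, hz, hzy⟩ := (key y).1 hy
    obtain ⟨s, t, hs, ht, hd, hk, rfl⟩ := hx
    obtain ⟨s', t', hs', ht', -, hk', rfl⟩ := hz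
    obtain ⟨y1, y2⟩ := y
    simp only [dirNE] at hyx hzy
    have hss : s' ≤ s := by
      by_contra! h
      have := hA.col_lt h hs' hd
      omega
    have htt : t' ≤ t := by
      by_contra! h
      have := hB.col_lt h ht' hd
      omega
    obtain rfl : s' = s := by omega
    obtain rfl : t' = t := by omega
    simp only [Prod.mk.injEq]
    omega

theorem skeleton_diagFrom (hA : IsSYT r c A) (hB : IsSYT r c B) {k : ℕ} (hr : r ≤ k + 1) :
    skeleton dirNE (diagFrom r c A B k 0) = diagFrom r c A B (k + 1) 0 := by
  simp only [skeleton, shadowLine_diagFrom hA hB, lineSkeleton_diagCol hA hB hr]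
  ext p
  simp only [Set.mem_iUnion]
  constructor
  · rintro ⟨d, s, t, hs, ht, hd, hk, rfl⟩
    exact ⟨s, t, d, hs, ht, hd, Nat.zero_le _, hk, rfl⟩
  · rintro ⟨s, t, d, hs, ht, hd, -, hk, rfl⟩
    exact ⟨d, s, t, hs, ht, hd, hk, rfl⟩

theorem skeletonIter_diagFrom (hA : IsSYT r c A) (hB : IsSYT r c B) {k : ℕ} (hr : r ≤ k + 1)
    (i : ℕ) :
    skeletonIter dirNE (diagFrom r c A B k 0) i = diagFrom r c A B (k + i) 0 := by
  induction i with
  | zero => rfl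
  | succ i ih =>
    rw [skeletonIter, Function.iterate_succ_apply', ← skeletonIter, ih,
      skeleton_diagFrom hA hB (by omega), add_assoc]

theorem exitSet_minSnd_diagFrom (hA : IsSYT r c A) (hB : IsSYT r c B) (i : ℕ) :
    exitSet IsMinSnd dirNE (diagFrom r c A B (r - 1) 0) i =
      {v | i < r ∧ ∃ j < c, v = (B i j : ℤ)} := by
  simp only [exitSet, skeletonIter_diagFrom hA hB (show r ≤ r - 1 + 1 by omega),
    shadowLine_diagFrom hA hB]
  ext v
  constructor
  · rintro ⟨j, ⟨_, ⟨s, t, hs, ht, hj, hk, rfl⟩, rfl⟩, hmin⟩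
    refine ⟨by omega, j, hj, le_antisymm ?_ ?_⟩
    · exact hmin _ ⟨r - 1, i, by omega, by omega, hj, by omega, rfl⟩
    · exact Nat.cast_le.2 (hB.col_le (by omega) ht hj)
  · rintro ⟨hi, j, hj, rfl⟩
    refine ⟨j, ⟨_, ⟨r - 1, i, by omega, hi, hj, by omega, rfl⟩, rfl⟩, ?_⟩
    rintro _ ⟨s, t, hs, ht, -, hk, rfl⟩
    exact Nat.cast_le.2 (hB.col_le (by omega) ht hj)

theorem exitSet_minFst_diagFrom (hA : IsSYT r c A) (hB : IsSYT r c B) (i : ℕ) :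
    exitSet IsMinFst dirNE (diagFrom r c A B (r - 1) 0) i =
      {v | i < r ∧ ∃ j < c, v = (A i j : ℤ)} := by
  simp only [exitSet, skeletonIter_diagFrom hA hB (show r ≤ r - 1 + 1 by omega),
    shadowLine_diagFrom hA hB]
  ext v
  constructor
  · rintro ⟨j, ⟨_, ⟨s, t, hs, ht, hj, hk, rfl⟩, rfl⟩, hmin⟩
    refine ⟨by omega, j, hj, le_antisymm ?_ ?_⟩
    · exact hmin _ ⟨i, r - 1, by omega, by omega, hj, by omega, rfl⟩
    · exact Nat.cast_le.2 (hA.col_le (by omega) hs hj)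
  · rintro ⟨hi, j, hj, rfl⟩
    refine ⟨j, ⟨_, ⟨i, r - 1, hi, by omega, hj, by omega, rfl⟩, rfl⟩, ?_⟩
    rintro _ ⟨s, t, hs, ht, -, hk, rfl⟩
    exact Nat.cast_le.2 (hA.col_le (by omega) hs hj)

theorem readsWord_toListT {spec : Set (ℤ × ℤ) → ℤ → Prop} {d : ℤ × ℤ → ℤ × ℤ → Prop}
    {X : Set (ℤ × ℤ)} {T : ℕ → ℕ → ℕ} (hT : IsSYT r c T)
    (h : ∀ i, exitSet spec d X i = {v | i < r ∧ ∃ j < c, v = (T i j : ℤ)}) :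
    ReadsWord spec (· < ·) d X (toListT r c T) := by
  refine ⟨fun m => (m.1 : ℤ) + 1, ?_, ?_, ?_⟩
  · intro a b hab
    have : a.1 < b.1 := hab
    simp only
    omega
  · ext v
    simp only [Set.mem_range, Set.mem_iUnion, h, Set.mem_ofPred_eq]
    constructor
    · rintro ⟨⟨m, hm⟩, rfl⟩
      rw [length_flatten_toListT] at hm
      obtain ⟨i, j, hi, hj, hij⟩ := hT.exists_eq (Nat.le_add_left 1 m) hm
      exact ⟨i, hi, j, hj, by rw [hij]; push_cast; rfl⟩
    · rintro ⟨i, hi, j, hj, rfl⟩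
      have := hT.mem_Icc hi hj
      refine ⟨⟨T i j - 1, ?_⟩, ?_⟩
      · rw [length_flatten_toListT]
        omega
      · simp only
        omega
  · rintro ⟨m, hm⟩ i hmem
    rw [h] at hmem
    obtain ⟨hi, j, hj, hij⟩ := hmem
    have hij : m + 1 = T i j := by
      simp only at hij
      omega
    simp only [hij, findIdx_toListT hT hi hj]

/-- Viennot's construction on the points `(A s d, B t d)`, where `s + t = r - 1`. -/
theorem viennotNE_diagFrom (hA : IsSYT r c A) (hB : IsSYT r c B) :
    ViennotNE (diagFrom r c A B (r - 1) 0) (toListT r c B) (toListT r c A) :=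
  ⟨readsWord_toListT hB (exitSet_minSnd_diagFrom hA hB),
    readsWord_toListT hA (exitSet_minFst_diagFrom hA hB)⟩

end Viennot

theorem find?_range_eq_some {n k₀ : ℕ} {p : ℕ → Bool} (hk : k₀ < n) (h : p k₀)
    (hlt : ∀ k < k₀, ¬ p k) : (List.range n).find? p = some k₀ := by
  rw [List.find?_range_eq_some]
  exact ⟨h, by simpa using hk, fun k hk => by simpa using hlt k hk⟩

theorem find?_range_eq_none {n : ℕ} {p : ℕ → Bool} (h : ∀ k < n, ¬ p k) :
    (List.range n).find? p = none := by
  simpa using h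

section Gromotion

variable {R C : ℕ} {T : ℕ → ℕ → ℕ}

theorem slidePath_mem (hR : 0 < R) (hC : 0 < C) {k : ℕ} (hk : k ≤ R + C - 2) :
    (slidePath R C T k).1 < R ∧ (slidePath R C T k).2 < C ∧
      (slidePath R C T k).1 + (slidePath R C T k).2 = k := by
  induction k with
  | zero => exact ⟨hR, hC, rfl⟩
  | succ k ih =>
    obtain ⟨h1, h2, h3⟩ := ih (by omega)
    rw [slidePath]
    generalize slidePath R C T k = p at *
    obtain ⟨a, b⟩ := p
    simp only [nextCell, ext] at *
    split_ifs with h h' h' <;> simp_all <;> omega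

theorem slidePath_mono {k l : ℕ} (h : k ≤ l) :
    (slidePath R C T k).1 ≤ (slidePath R C T l).1 ∧
      (slidePath R C T k).2 ≤ (slidePath R C T l).2 := by
  induction l, h using Nat.le_induction with
  | base => exact ⟨le_rfl, le_rfl⟩
  | succ l _ ih =>
    rw [slidePath, nextCell]
    split_ifs <;> simp only <;> omega

theorem gromotion_slidePath (hR : 0 < R) (hC : 0 < C) {k : ℕ} (hk : k < R + C - 2) :
    gromotion R C T (slidePath R C T k).1 (slidePath R C T k).2 =
      T (slidePath R C T (k + 1)).1 (slidePath R C T (k + 1)).2 := by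
  have h := (slidePath_mem (T := T) hR hC hk.le).2.2
  rw [gromotion, if_neg (by omega), find?_range_eq_some hk (by simp)]
  intro l hl h'
  have := (slidePath_mem (T := T) hR hC (show l ≤ R + C - 2 by omega)).2.2
  simp only [Prod.mk.eta, decide_eq_true_eq] at h'
  rw [h'] at this
  omega

theorem gromotion_of_not_mem_slidePath {i j : ℕ} (hij : ¬ (i = R - 1 ∧ j = C - 1))
    (h : ∀ k < R + C - 2, slidePath R C T k ≠ (i, j)) : gromotion R C T i j = T i j := by
  rw [gromotion, if_neg hij, find?_range_eq_none (by simpa using h)]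

theorem lt_gromotion_corner {i j : ℕ} (hi : i < R) (hj : j < C) :
    T i j < gromotion R C T (R - 1) (C - 1) := by
  rw [gromotion, if_pos ⟨rfl, rfl⟩, Nat.lt_succ_iff, maxEntry]
  exact Finset.le_sup (f := fun p : ℕ × ℕ => T p.1 p.2) (b := (i, j)) (by simp [hi, hj])

theorem slideInto_of_slidePath {k i : ℕ} (hk : k < R + C - 1) (h : (slidePath R C T k).1 = i)
    (hlt : ∀ l < k, (slidePath R C T l).1 < i) :
    slideInto R C T i = T (slidePath R C T k).1 (slidePath R C T k).2 := by
  rw [slideInto, find?_range_eq_some hk (by simpa using h)]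
  intro l hl
  simpa using (hlt l hl).ne

end Gromotion

theorem add_lt_length_flatten {D : List (List ℕ)} {a b : ℕ}
    (h : ∀ i ≤ a, b < (D.getD i []).length) : a + b < D.flatten.length := by
  induction a generalizing D with
  | zero =>
    cases D with
    | nil => simpa using h 0 le_rfl
    | cons row D =>
      have := h 0 le_rfl
      simp only [List.getD_cons_zero] at this
      simp only [List.flatten_cons, List.length_append]
      omega
  | succ a ih =>
    cases D with
    | nil => simpa using h 0 (Nat.zero_le _)
    | cons row D =>
      have h0 := h 0 (Nat.zero_le _)
      have := ih (D := D) fun i hi => by simpa using h (i + 1) (by omega)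
      simp only [List.getD_cons_zero] at h0
      simp only [List.flatten_cons, List.length_append]
      omega

theorem getD_filter_ne_nil {L : List (List ℕ)}
    (h : ∀ i j, i ≤ j → (L.getD j []).length ≤ (L.getD i []).length) (i : ℕ) :
    (L.filter fun row => decide (row ≠ [])).getD i [] = L.getD i [] := by
  induction L generalizing i with
  | nil => rfl
  | cons row L ih =>
    by_cases hrow : row = []
    · have hnil : ∀ j, (row :: L).getD j [] = [] := by
        intro j
        have := h 0 j (Nat.zero_le _)
        have hlen : row.length = 0 := by simp [hrow]
        rw [List.getD_cons_zero] at this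
        exact List.length_eq_zero_iff.1 (by omega)
      have : (row :: L).filter (fun row => decide (row ≠ [])) = [] := by
        rw [List.filter_eq_nil_iff]
        intro a ha
        obtain ⟨j, hj, rfl⟩ := List.getElem_of_mem ha
        have := hnil j
        rw [List.getD_eq_getElem _ _ hj] at this
        simp [this]
      rw [this, hnil, List.getD_nil]
    · rw [List.filter_cons_of_pos (by simpa using hrow)]
      cases i with
      | zero => rfl
      | succ i =>
        simp only [List.getD_cons_succ]
        exact ih (fun i j hij => by simpa using h (i + 1) (j + 1) (by omega)) i

theorem getD_map_range {α : Type*} (f : ℕ → α) (n i : ℕ) (d : α) :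
    ((List.range n).map f).getD i d = if i < n then f i else d := by
  split_ifs with h
  · rw [List.getD_eq_getElem _ _ (by simpa using h)]
    simp
  · rw [List.getD_eq_default _ _ (by simpa using h)]

/-- The rows of `delta D`, including the one which may have become empty. -/
theorem getD_delta {D : List (List ℕ)}
    (h : ∀ i j, i ≤ j → (D.getD j []).length - (if j = (vacated D).1 then 1 else 0) ≤
      (D.getD i []).length - (if i = (vacated D).1 then 1 else 0)) (i : ℕ) :
    (delta D).getD i [] =
      (List.range ((D.getD i []).length - if i = (vacated D).1 then 1 else 0)).map fun j =>
        slidValue D i j := by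
  have key : ∀ i, ((List.range D.length).map fun i =>
      (List.range ((D.getD i []).length - if i = (vacated D).1 then 1 else 0)).map fun j =>
        slidValue D i j).getD i [] =
      (List.range ((D.getD i []).length - if i = (vacated D).1 then 1 else 0)).map fun j =>
        slidValue D i j := by
    intro i
    rw [getD_map_range]
    split_ifs with h1 h2 h2
    · rfl
    · rfl
    all_goals rw [List.getD_eq_default _ _ (by omega)]; simp
  rw [delta, getD_filter_ne_nil, key]
  intro i j hij
  rw [key, key]
  simpa using h i j hij

/-- The state of the tableau `T` obtained from `stack P Q` by some number of gromotions: the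
top of the `d`-th column consists of the `h d` entries of the list tableau `D` (what remains
of `P`), followed by the `d`-th column of `Q` (shifted by `r * c`), followed by entries larger
than `2 * (r * c)`. -/
structure Stage (r c : ℕ) (Q T : ℕ → ℕ → ℕ) (D : List (List ℕ)) (h : ℕ → ℕ) : Prop where
  anti : Antitone h
  le : ∀ d, h d ≤ r
  zero : ∀ d, c ≤ d → h d = 0
  mem : ∀ i d, d < (D.getD i []).length ↔ i < h d
  entry : ∀ i d, i < h d → entryL D i d = T i d
  small : ∀ i d, i < h d → T i d ≤ r * c
  mid : ∀ i d, i < r → d < c → T (h d + i) d = Q i d + r * c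
  big : ∀ i d, i < 2 * r → d < c → h d + r ≤ i → 2 * (r * c) < T i d

/-- The outer corner where the slides in `D` end is `(t, d)`, and until then they agree with the
slides in `T`. -/
structure SlideData (r c : ℕ) (T : ℕ → ℕ → ℕ) (D : List (List ℕ)) (h : ℕ → ℕ) (t d : ℕ) :
    Prop where
  height : h d = t + 1
  corner : h (d + 1) ≤ t
  inside : ∀ k ≤ t + d, (jdtPath D k).1 < h (jdtPath D k).2
  sum : ∀ k ≤ t + d, (jdtPath D k).1 + (jdtPath D k).2 = k
  eq : ∀ k ≤ t + d, slidePath (2 * r) c T k = jdtPath D k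
  stationary : ∀ k, t + d ≤ k → jdtPath D k = (t, d)
  len : t + d < D.flatten.length

namespace Stage

variable {r c : ℕ} {Q T : ℕ → ℕ → ℕ} {D : List (List ℕ)} {h : ℕ → ℕ}

theorem lt_of_lt (hS : Stage r c Q T D h) {i d : ℕ} (hi : i < h d) : i < r ∧ d < c := by
  refine ⟨hi.trans_le (hS.le d), ?_⟩
  by_contra! hd
  have := hS.zero d hd
  omega

theorem ext_of_lt (hS : Stage r c Q T D h) {i d : ℕ} (hi : i < h d) :
    ext (2 * r) c T (i, d) = (T i d : ℕ) ∧ extL D (i, d) = (T i d : ℕ) := by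
  have := hS.lt_of_lt hi
  rw [ext, extL, if_pos (by simp only; omega), if_pos ((hS.mem i d).2 hi), hS.entry i d hi]
  exact ⟨rfl, rfl⟩

theorem lt_of_le (hQ : IsSYT r c Q) (hS : Stage r c Q T D h) {i d : ℕ} (hi : h d ≤ i)
    (hi' : i < 2 * r) (hd : d < c) : r * c < T i d := by
  by_cases hir : i < h d + r
  · have := hS.mid (i - h d) d (by omega) hd
    rw [Nat.add_sub_cancel' hi] at this
    have := (hQ.mem_Icc (show i - h d < r by omega) hd).1
    omega
  · have := hS.big i d hi' hd (by omega)
    omega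

theorem ext_of_le (hQ : IsSYT r c Q) (hS : Stage r c Q T D h) {i d : ℕ} (hi : h d ≤ i) :
    ((r * c : ℕ) : WithTop ℕ) < ext (2 * r) c T (i, d) ∧ extL D (i, d) = ⊤ := by
  have hm := (hS.mem i d).not.2 (by omega)
  rw [ext, extL, if_neg hm]
  refine ⟨?_, rfl⟩
  split_ifs with hid
  · exact WithTop.coe_lt_coe.2 (hS.lt_of_le hQ hi hid.1 hid.2)
  · exact WithTop.coe_lt_top _

/-- Inside the diagram of `D`, the slides in `D` and in `T` agree. -/
theorem nextCellL_eq (hQ : IsSYT r c Q) (hS : Stage r c Q T D h) {p : ℕ × ℕ}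
    (hp : p.1 < h p.2) (hc : p.1 < h (p.2 + 1) ∨ p.1 + 1 < h p.2) :
    nextCell (2 * r) c T p = nextCellL D p ∧ (nextCellL D p).1 < h (nextCellL D p).2 ∧
      (nextCellL D p).1 + (nextCellL D p).2 = p.1 + p.2 + 1 := by
  obtain ⟨a, b⟩ := p
  simp only at hp hc
  rw [nextCell, nextCellL]
  simp only
  by_cases h1 : a < h (b + 1) <;> by_cases h2 : a + 1 < h b
  · rw [(hS.ext_of_lt h1).1, (hS.ext_of_lt h1).2, (hS.ext_of_lt h2).1, (hS.ext_of_lt h2).2,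
      if_neg (show ¬ (((T a (b + 1) : ℕ) : WithTop ℕ) = ⊤ ∧ _) by simp)]
    split_ifs <;> simp only [true_and] <;> omega
  · have hout := hS.ext_of_le hQ (show h b ≤ a + 1 by omega)
    have hsm : ((T a (b + 1) : ℕ) : WithTop ℕ) ≤ ((r * c : ℕ) : WithTop ℕ) :=
      WithTop.coe_le_coe.2 (hS.small _ _ h1)
    rw [(hS.ext_of_lt h1).1, (hS.ext_of_lt h1).2, hout.2, if_pos (hsm.trans_lt hout.1),
      if_neg (by simp), if_pos (WithTop.natCast_lt_top _)]
    simp only [true_and]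
    omega
  · have hout := hS.ext_of_le hQ (show h (b + 1) ≤ a by omega)
    have hsm : ((T (a + 1) b : ℕ) : WithTop ℕ) ≤ ((r * c : ℕ) : WithTop ℕ) :=
      WithTop.coe_le_coe.2 (hS.small _ _ h2)
    rw [(hS.ext_of_lt h2).1, (hS.ext_of_lt h2).2, hout.2,
      if_neg (hsm.trans hout.1.le).not_gt, if_neg (by simp), if_neg (by simp)]
    simp only [true_and]
    omega
  · omega

theorem nextCellL_corner (hQ : IsSYT r c Q) (hS : Stage r c Q T D h) {a b : ℕ}
    (h1 : h (b + 1) ≤ a) (h2 : h b ≤ a + 1) : nextCellL D (a, b) = (a, b) := by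
  rw [nextCellL, if_pos ⟨(hS.ext_of_le hQ h1).2, (hS.ext_of_le hQ h2).2⟩]

theorem add_lt_length (hS : Stage r c Q T D h) {a b : ℕ} (hab : a < h b) :
    a + b < D.flatten.length :=
  add_lt_length_flatten fun i hi => (hS.mem i b).2 (by omega)

theorem exists_slideData (hQ : IsSYT r c Q) (hS : Stage r c Q T D h) (h0 : 0 < h 0) :
    ∃ t d, SlideData r c T D h t d := by
  let stuck : ℕ → Prop := fun k =>
    ¬ ((jdtPath D k).1 < h ((jdtPath D k).2 + 1) ∨ (jdtPath D k).1 + 1 < h (jdtPath D k).2)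
  have key : ∀ k, (∀ l < k, ¬ stuck l) → (jdtPath D k).1 < h (jdtPath D k).2 ∧
      (jdtPath D k).1 + (jdtPath D k).2 = k ∧ slidePath (2 * r) c T k = jdtPath D k := by
    intro k
    induction k with
    | zero => exact fun _ => ⟨h0, rfl, rfl⟩
    | succ k ih =>
      intro hk
      obtain ⟨h1, h2, h3⟩ := ih fun l hl => hk l (by omega)
      obtain ⟨h4, h5, h6⟩ := hS.nextCellL_eq hQ h1 (not_not.1 (hk k k.lt_succ_self))
      refine ⟨h5, ?_, ?_⟩
      · rw [jdtPath, h6, h2]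
      · rw [slidePath, h3, h4, jdtPath]
  have hex : ∃ k, stuck k := by
    by_contra! hno
    obtain ⟨h1, h2, -⟩ := key D.flatten.length fun l _ => hno l
    have := hS.add_lt_length h1
    omega
  classical
  have hlt : ∀ l < Nat.find hex, ¬ stuck l := fun l hl => Nat.find_min hex hl
  have hst : stuck (Nat.find hex) := Nat.find_spec hex
  generalize Nat.find hex = k₀ at hlt hst
  obtain ⟨h1, h2, -⟩ := key k₀ hlt
  simp only [stuck, not_or, not_lt] at hst
  generalize hv : jdtPath D k₀ = v at h1 h2 hst
  obtain ⟨t, d⟩ := v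
  simp only at h1 h2 hst
  subst h2
  refine ⟨t, d, by omega, hst.1, ?_, ?_, ?_, ?_, hS.add_lt_length h1⟩
  · exact fun k hk => (key k fun l hl => hlt l (by omega)).1
  · exact fun k hk => (key k fun l hl => hlt l (by omega)).2.1
  · exact fun k hk => (key k fun l hl => hlt l (by omega)).2.2
  · intro k hk
    induction k, hk using Nat.le_induction with
    | base => exact hv
    | succ k _ ih => rw [jdtPath, ih, hS.nextCellL_corner hQ hst.1 hst.2]

variable {t d : ℕ}

theorem vacated_eq (hD : SlideData r c T D h t d) : vacated D = (t, d) :=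
  hD.stationary _ hD.len.le

/-- After leaving the diagram of `D`, the empty cell moves straight down through a column
of `Q`. -/
theorem slidePath_add (hQ : IsSYT r c Q) (hS : Stage r c Q T D h)
    (hD : SlideData r c T D h t d) {q : ℕ} (hq : q ≤ r) :
    slidePath (2 * r) c T (t + d + q) = (t + q, d) := by
  have hht := hD.height
  obtain ⟨htr, hdc⟩ := hS.lt_of_lt (show t < h d by omega)
  induction q with
  | zero => rw [add_zero, hD.eq _ le_rfl, hD.stationary _ le_rfl]; rfl
  | succ q ih =>
    rw [← add_assoc, slidePath, ih (by omega), nextCell, if_neg]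
    · rfl
    have hmid := hS.mid q d (by omega) hdc
    rw [hht, show t + 1 + q = t + q + 1 by omega] at hmid
    simp only [ext]
    rw [if_pos (show t + q + 1 < 2 * r ∧ d < c by omega), hmid]
    split_ifs with hin
    · rw [not_lt, Nat.cast_le]
      have hcor := hD.corner
      by_cases hlt : t + q < h (d + 1) + r
      · have h1 := hS.mid (t + q - h (d + 1)) (d + 1) (by omega) hin.2
        rw [show h (d + 1) + (t + q - h (d + 1)) = t + q by omega] at h1
        have h2 := hQ.col_le (show q ≤ t + q - h (d + 1) by omega) (by omega) hin.2
        have h3 := hQ.row_lt (show q < r by omega) (Nat.lt_succ_self d) hin.2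
        simp only [Nat.succ_eq_add_one] at h3
        omega
      · have h1 := hS.big _ _ hin.1 hin.2 (by omega)
        have h2 := (hQ.mem_Icc (show q < r by omega) hdc).2
        omega
    · simp

theorem slideInto_eq (hQ : IsSYT r c Q) (hS : Stage r c Q T D h)
    (hD : SlideData r c T D h t d) :
    slideInto (2 * r) c T r = Q (r - 1 - t) d + r * c := by
  have hht := hD.height
  obtain ⟨htr, hdc⟩ := hS.lt_of_lt (show t < h d by omega)
  have hp := hS.slidePath_add hQ hD (show r - t ≤ r by omega)
  have hp' := hS.slidePath_add hQ hD (show r - t - 1 ≤ r by omega)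
  rw [slideInto_of_slidePath (k := t + d + (r - t)) (by omega)]
  · rw [hp, ← hS.mid (r - 1 - t) d (by omega) hdc, hht]
    simp only
    congr 1
    omega
  · rw [hp]
    simp only
    omega
  · intro l hl
    have := (slidePath_mono (R := 2 * r) (C := c) (T := T)
      (show l ≤ t + d + (r - t - 1) by omega)).1
    rw [hp'] at this
    simp only at this
    omega

theorem slidValue_eq (hQ : IsSYT r c Q) (hS : Stage r c Q T D h)
    (hD : SlideData r c T D h t d) {i j : ℕ} (hij : i < Function.update h d t j) :
    slidValue D i j = gromotion (2 * r) c T i j ∧ gromotion (2 * r) c T i j ≤ r * c := by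
  have hht := hD.height
  have hcor := hD.corner
  have hlen := hD.len
  obtain ⟨htr, hdc⟩ := hS.lt_of_lt (show t < h d by omega)
  have hij' : i < h j := by
    by_cases hj : j = d
    · subst hj
      rw [Function.update_self] at hij
      omega
    · rwa [Function.update_of_ne hj] at hij
  have hne : (i, j) ≠ (t, d) := by
    rintro h
    simp only [Prod.mk.injEq] at h
    obtain ⟨rfl, rfl⟩ := h
    simp at hij
  have hir := hS.lt_of_lt hij'
  by_cases hk : ∃ k < t + d, jdtPath D k = (i, j)
  · obtain ⟨k, hk, hkij⟩ := hk
    have hnext : (jdtPath D (k + 1)).1 < h (jdtPath D (k + 1)).2 := hD.inside (k + 1) hk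
    have hg := gromotion_slidePath (T := T) (show 0 < 2 * r by omega) (show 0 < c by omega)
      (show k < 2 * r + c - 2 by omega)
    rw [hD.eq k hk.le, hD.eq (k + 1) hk, hkij] at hg
    simp only at hg
    rw [hg]
    refine ⟨?_, hS.small _ _ hnext⟩
    rw [slidValue, find?_range_eq_some (k₀ := k) (by omega)]
    · exact hS.entry _ _ hnext
    · have h1 := hD.sum k hk.le
      have h2 := hD.sum (k + 1) hk
      simp only [decide_eq_true_eq]
      refine ⟨hkij, fun heq => ?_⟩
      rw [hkij] at h1
      rw [heq] at h2
      omega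
    · intro l hl
      have h1 := hD.sum k hk.le
      have h2 := hD.sum l (by omega)
      simp only [decide_eq_true_eq, not_and]
      intro heq
      rw [hkij] at h1
      rw [heq] at h2
      omega
  · have hg : gromotion (2 * r) c T i j = T i j := by
      apply gromotion_of_not_mem_slidePath (by omega)
      intro k _ hkij
      by_cases hle : k ≤ t + d
      · rw [hD.eq k hle] at hkij
        rcases hle.eq_or_lt with rfl | hlt
        · exact hne (hkij.symm.trans (hD.stationary _ le_rfl))
        · exact hk ⟨k, hlt, hkij⟩
      · have hm := slidePath_mono (R := 2 * r) (C := c) (T := T) (show t + d + 1 ≤ k by omega)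
        rw [hS.slidePath_add hQ hD (by omega), hkij] at hm
        have := hS.anti hm.2
        simp only at hm this
        omega
    rw [hg]
    refine ⟨?_, hS.small _ _ hij'⟩
    rw [slidValue, find?_range_eq_none]
    · exact hS.entry _ _ hij'
    · intro k _
      simp only [decide_eq_true_eq, not_and]
      intro hkij
      by_cases hle : k < t + d
      · exact absurd ⟨k, hle, hkij⟩ hk
      · exact absurd (hkij.symm.trans (hD.stationary k (by omega))) hne

theorem update_anti (hS : Stage r c Q T D h) (hD : SlideData r c T D h t d) :
    Antitone (Function.update h d t) := by
  have hht := hD.height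
  have hcor := hD.corner
  intro a b hab
  simp only [Function.update_apply]
  have hanti := hS.anti hab
  split_ifs with h1 h2 h2
  · exact le_rfl
  · subst h1
    omega
  · subst h2
    have := hS.anti (show a + 1 ≤ b by omega)
    omega
  · exact hanti

theorem length_sub_iff (hS : Stage r c Q T D h) (hD : SlideData r c T D h t d) (i j : ℕ) :
    j < (D.getD i []).length - (if i = (vacated D).1 then 1 else 0) ↔
      i < Function.update h d t j := by
  have hht := hD.height
  have hcor := hD.corner
  rw [vacated_eq hD, Function.update_apply]
  have h1 := hS.mem i j
  have h2 := hS.mem t d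
  have h3 := hS.mem t (d + 1)
  simp only
  split_ifs with hi hj hj
  · subst hi hj
    omega
  · subst hi
    omega
  · subst hj
    omega
  · omega

theorem getD_delta_eq (hS : Stage r c Q T D h) (hD : SlideData r c T D h t d) (i : ℕ) :
    (delta D).getD i [] =
      (List.range ((D.getD i []).length - if i = (vacated D).1 then 1 else 0)).map fun j =>
        slidValue D i j := by
  apply getD_delta
  intro i j hij
  by_contra! hlt
  have h1 := (hS.length_sub_iff hD j _).1 hlt
  have h2 := (hS.length_sub_iff hD i _).2 (hij.trans_lt h1)
  omega

/-- Gromotion of `T` amounts to deletion and rectification of `D`. -/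
theorem step (hQ : IsSYT r c Q) (hS : Stage r c Q T D h) (hD : SlideData r c T D h t d) :
    Stage r c Q (gromotion (2 * r) c T) (delta D) (Function.update h d t) := by
  have hht := hD.height
  have hcor := hD.corner
  obtain ⟨htr, hdc⟩ := hS.lt_of_lt (show t < h d by omega)
  have hR : 0 < 2 * r := by omega
  have hC : 0 < c := by omega
  have hle : ∀ j, Function.update h d t j ≤ h j := by
    intro j
    rw [Function.update_apply]
    split_ifs with hj
    · subst hj
      omega
    · exact le_rfl
  have hpath : ∀ k, k ≤ t + d ∨ (∃ q < r, 0 < q ∧ k = t + d + q) ∨ t + d + r ≤ k := by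
    intro k
    by_cases h1 : k ≤ t + d
    · exact Or.inl h1
    · by_cases h2 : t + d + r ≤ k
      · exact Or.inr (Or.inr h2)
      · exact Or.inr (Or.inl ⟨k - (t + d), by omega, by omega, by omega⟩)
  refine ⟨hS.update_anti hD, fun j => (hle j).trans (hS.le j), ?_, ?_, ?_, ?_, ?_, ?_⟩
  · intro j hj
    have := hle j
    rw [hS.zero j hj] at this
    omega
  · intro i j
    rw [hS.getD_delta_eq hD, List.length_map, List.length_range]
    exact hS.length_sub_iff hD i j
  · intro i j hij
    rw [entryL, hS.getD_delta_eq hD, getD_map_range, if_pos ((hS.length_sub_iff hD i j).2 hij)]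
    exact (hS.slidValue_eq hQ hD hij).1
  · exact fun i j hij => (hS.slidValue_eq hQ hD hij).2
  · intro i j hi hj
    rw [← hS.mid i j hi hj]
    by_cases hjd : j = d
    · subst hjd
      rw [Function.update_self, hht]
      have hg := gromotion_slidePath (T := T) hR hC (show t + j + i < 2 * r + c - 2 by omega)
      rw [hS.slidePath_add hQ hD hi.le, add_assoc, hS.slidePath_add hQ hD hi] at hg
      rw [hg, show t + 1 + i = t + (i + 1) by omega]
    · rw [Function.update_of_ne hjd]
      have hanti : d < j → h j ≤ t := fun hlt => (hS.anti (show d + 1 ≤ j by omega)).trans hcor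
      have hjr := hS.le j
      apply gromotion_of_not_mem_slidePath (by omega)
      intro k _ hk
      rcases hpath k with hk' | ⟨q, hq, -, rfl⟩ | hk'
      · have := hD.inside k hk'
        rw [← hD.eq k hk', hk] at this
        simp only at this
        omega
      · rw [hS.slidePath_add hQ hD hq.le] at hk
        simp only [Prod.mk.injEq] at hk
        omega
      · have hm := slidePath_mono (R := 2 * r) (C := c) (T := T) hk'
        rw [hS.slidePath_add hQ hD le_rfl, hk] at hm
        simp only at hm
        omega
  · intro i j hi hj hij
    by_cases hcr : i = 2 * r - 1 ∧ j = c - 1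
    · obtain ⟨rfl, rfl⟩ := hcr
      obtain ⟨a, b, ha, hb, hab⟩ := hQ.exists_eq
        (show 1 ≤ r * c from Nat.mul_pos (by omega) hC) le_rfl
      have h1 := hS.mid a b ha hb
      have h2 := lt_gromotion_corner (R := 2 * r) (C := c) (T := T) (i := h b + a) (j := b)
        (by have := hS.le b; omega) hb
      omega
    · by_cases hk : ∃ k < 2 * r + c - 2, slidePath (2 * r) c T k = (i, j)
      · obtain ⟨k, hk, hkij⟩ := hk
        have hg := gromotion_slidePath (T := T) hR hC hk
        obtain ⟨m1, m2, -⟩ := slidePath_mem (T := T) hR hC (show k + 1 ≤ 2 * r + c - 2 by omega)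
        rw [hkij] at hg
        simp only at hg
        rw [hg]
        refine hS.big _ _ m1 m2 ?_
        rcases hpath k with hk' | ⟨q, hq, -, rfl⟩ | hk'
        · have := hD.inside k hk'
          rw [← hD.eq k hk', hkij] at this
          have hjr := hS.le j
          simp only at this
          omega
        · rw [hS.slidePath_add hQ hD hq.le] at hkij
          simp only [Prod.mk.injEq] at hkij
          obtain ⟨rfl, rfl⟩ := hkij
          rw [Function.update_self] at hij
          omega
        · have hm := slidePath_mono (R := 2 * r) (C := c) (T := T) hk'
          rw [hS.slidePath_add hQ hD le_rfl, hkij] at hm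
          simp only at hm
          rw [slidePath, hkij, nextCell]
          split_ifs
          · have := hS.anti (show d + 1 ≤ j + 1 by omega)
            simp only
            omega
          · have := hS.anti hm.2
            simp only
            omega
      · push Not at hk
        rw [gromotion_of_not_mem_slidePath hcr hk]
        refine hS.big _ _ hi hj ?_
        by_cases hjd : j = d
        · subst hjd
          rw [Function.update_self] at hij
          by_contra hlt
          obtain rfl : i = t + r := by omega
          exact hk (t + j + r) (by omega) (hS.slidePath_add hQ hD le_rfl)
        · rwa [Function.update_of_ne hjd] at hij

end Stage

theorem Stage.height_pos {r c : ℕ} {Q T : ℕ → ℕ → ℕ} {D : List (List ℕ)} {h : ℕ → ℕ}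
    (hS : Stage r c Q T D h) (hsum : 0 < ∑ d ∈ Finset.range c, h d) : 0 < h 0 := by
  obtain ⟨d, -, hd⟩ := Finset.exists_ne_zero_of_sum_ne_zero hsum.ne'
  have := hS.anti (Nat.zero_le d)
  omega

section Evacuation

variable {r c : ℕ} {P Q : ℕ → ℕ → ℕ}

/-- The column heights of what remains of `P` after `k` deletions and rectifications. -/
def remHeight (r c : ℕ) (P : ℕ → ℕ → ℕ) : ℕ → ℕ → ℕ
  | 0 => fun d => if d < c then r else 0
  | k + 1 => Function.update (remHeight r c P k) (vacated (delta^[k] (toListT r c P))).2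
      (vacated (delta^[k] (toListT r c P))).1

theorem remHeight_zero (d : ℕ) : remHeight r c P 0 d = if d < c then r else 0 :=
  rfl

theorem getD_toListT (P : ℕ → ℕ → ℕ) (i : ℕ) :
    (toListT r c P).getD i [] = if i < r then (List.range c).map (P i) else [] :=
  getD_map_range _ _ _ _

theorem stage_zero (hP : IsSYT r c P) :
    Stage r c Q (stack r c P Q) (toListT r c P) (remHeight r c P 0) := by
  have hcell : ∀ i d, i < remHeight r c P 0 d ↔ i < r ∧ d < c := by
    intro i d
    rw [remHeight_zero]
    split_ifs with hd <;> simp [hd]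
  refine ⟨?_, ?_, ?_, ?_, ?_, ?_, ?_, ?_⟩
  · intro a b hab
    simp only [remHeight_zero]
    split_ifs <;> omega
  · intro d
    simp only [remHeight_zero]
    split_ifs <;> omega
  · intro d hd
    simp only [remHeight_zero]
    rw [if_neg (by omega)]
  · intro i d
    rw [hcell, getD_toListT]
    split_ifs with hi <;> simp [hi]
  · intro i d hid
    obtain ⟨hi, hd⟩ := (hcell i d).1 hid
    rw [entryL, getD_toListT, if_pos hi, getD_map_range, if_pos hd, stack, if_pos hi]
  · intro i d hid
    obtain ⟨hi, hd⟩ := (hcell i d).1 hid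
    rw [stack, if_pos hi]
    exact (hP.mem_Icc hi hd).2
  · intro i d _ hd
    rw [remHeight_zero, if_pos hd, stack, if_neg (by omega), Nat.add_sub_cancel_left]
  · intro i d hi hd h
    rw [remHeight_zero, if_pos hd] at h
    omega

theorem stage_iterate (hP : IsSYT r c P) (hQ : IsSYT r c Q) {k : ℕ} (hk : k ≤ r * c) :
    Stage r c Q ((gromotion (2 * r) c)^[k] (stack r c P Q)) (delta^[k] (toListT r c P))
        (remHeight r c P k) ∧
      ∑ d ∈ Finset.range c, remHeight r c P k d = r * c - k := by
  induction k with
  | zero =>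
    refine ⟨stage_zero hP, ?_⟩
    rw [Finset.sum_congr rfl fun d hd =>
      (remHeight_zero d).trans (if_pos (Finset.mem_range.1 hd))]
    simp [mul_comm]
  | succ k ih =>
    obtain ⟨hS, hsum⟩ := ih (by omega)
    obtain ⟨t, d, hD⟩ := hS.exists_slideData hQ (hS.height_pos (by omega))
    have hv := Stage.vacated_eq hD
    have hht := hD.height
    have hdc := (hS.lt_of_lt (show t < remHeight r c P k d by omega)).2
    rw [Function.iterate_succ_apply', Function.iterate_succ_apply', remHeight, hv]
    refine ⟨hS.step hQ hD, ?_⟩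
    have hmem := Finset.mem_range.2 hdc
    rw [Finset.sum_update_of_mem hmem]
    rw [Finset.sum_eq_add_sum_sdiff_singleton_of_mem hmem] at hsum
    omega

theorem slideData_iterate (hP : IsSYT r c P) (hQ : IsSYT r c Q) {k : ℕ} (hk : k < r * c) :
    SlideData r c ((gromotion (2 * r) c)^[k] (stack r c P Q)) (delta^[k] (toListT r c P))
      (remHeight r c P k) (vacated (delta^[k] (toListT r c P))).1
      (vacated (delta^[k] (toListT r c P))).2 := by
  obtain ⟨hS, hsum⟩ := stage_iterate hP hQ hk.le
  obtain ⟨t, d, hD⟩ := hS.exists_slideData hQ (hS.height_pos (by omega))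
  rwa [Stage.vacated_eq hD]

theorem remHeight_le (hP : IsSYT r c P) (hQ : IsSYT r c Q) {k l : ℕ} (hkl : k ≤ l)
    (hl : l ≤ r * c) (d : ℕ) : remHeight r c P l d ≤ remHeight r c P k d := by
  induction l, hkl using Nat.le_induction with
  | base => exact le_rfl
  | succ l _ ih =>
    refine le_trans ?_ (ih (by omega))
    have := (slideData_iterate hP hQ (show l < r * c by omega)).height
    rw [remHeight, Function.update_apply]
    split_ifs with hd
    · subst hd
      omega
    · exact le_rfl

theorem lt_remHeight_of_vacated (hP : IsSYT r c P) (hQ : IsSYT r c Q) {k t d : ℕ}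
    (hk : k < r * c) (hv : vacated (delta^[k] (toListT r c P)) = (t, d)) :
    t < remHeight r c P k d := by
  have := (slideData_iterate hP hQ hk).height
  rw [hv] at this
  simp only at this
  omega

theorem le_of_lt_remHeight (hP : IsSYT r c P) (hQ : IsSYT r c Q) {k l t d : ℕ}
    (hk : k ≤ r * c) (ht : t < remHeight r c P k d)
    (hv : vacated (delta^[l] (toListT r c P)) = (t, d)) : k ≤ l := by
  by_contra! hlk
  have := remHeight_le hP hQ (show l + 1 ≤ k from hlk) hk d
  rw [remHeight, hv, Function.update_self] at this
  simp only at this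
  omega

theorem vacated_inj (hP : IsSYT r c P) (hQ : IsSYT r c Q) {k l : ℕ} (hk : k < r * c)
    (hl : l < r * c) (h : vacated (delta^[k] (toListT r c P)) =
      vacated (delta^[l] (toListT r c P))) : k = l :=
  le_antisymm (le_of_lt_remHeight hP hQ hk.le (lt_remHeight_of_vacated hP hQ hk rfl) h.symm)
    (le_of_lt_remHeight hP hQ hl.le (lt_remHeight_of_vacated hP hQ hl rfl) h)

theorem exists_vacated (hP : IsSYT r c P) (hQ : IsSYT r c Q) {t d : ℕ} (ht : t < r)
    (hd : d < c) : ∃ k < r * c, vacated (delta^[k] (toListT r c P)) = (t, d) := by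
  have hn : remHeight r c P (r * c) d ≤ t := by
    have h := (stage_iterate hP hQ (le_refl (r * c))).2
    rw [Nat.sub_self, Finset.sum_eq_zero_iff] at h
    rw [h d (Finset.mem_range.2 hd)]
    exact Nat.zero_le t
  have hex : ∃ k, remHeight r c P k d ≤ t := ⟨_, hn⟩
  have hspec := Nat.find_spec hex
  have hle := Nat.find_min' hex hn
  have hmin := fun l => Nat.find_min hex (m := l)
  generalize Nat.find hex = k at *
  cases k with
  | zero =>
    rw [remHeight_zero, if_pos hd] at hspec
    omega
  | succ k =>
    have h1 := hmin k k.lt_succ_self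
    have h2 := (slideData_iterate hP hQ (show k < r * c by omega)).height
    refine ⟨k, by omega, ?_⟩
    rw [remHeight, Function.update_apply] at hspec
    split_ifs at hspec with hdv
    · ext
      · rw [← hdv] at h2
        simp only
        omega
      · exact hdv.symm
    · omega

theorem evacEntry_eq (hP : IsSYT r c P) (hQ : IsSYT r c Q) {k t d : ℕ} (hk : k < r * c)
    (hv : vacated (delta^[k] (toListT r c P)) = (t, d)) :
    evacEntry (toListT r c P) t d = r * c - k := by
  rw [evacEntry, length_flatten_toListT, find?_range_eq_some hk (by simpa using hv)]
  intro l hl h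
  have := vacated_inj hP hQ (hl.trans hk) hk ((of_decide_eq_true h).trans hv.symm)
  omega

theorem evacL_toListT (P : ℕ → ℕ → ℕ) :
    evacL (toListT r c P) = toListT r c (evacEntry (toListT r c P)) := by
  have hlen : (toListT r c P).length = r := by simp [toListT]
  rw [evacL, hlen]
  conv_rhs => rw [toListT]
  refine List.map_congr_left fun i hi => ?_
  rw [getD_toListT, if_pos (List.mem_range.1 hi), List.length_map, List.length_range]

/-- Evacuation of a rectangular standard tableau is again a standard tableau. -/
theorem isSYT_evacEntry (hP : IsSYT r c P) (hQ : IsSYT r c Q) :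
    IsSYT r c (evacEntry (toListT r c P)) := by
  have key : ∀ t d t' d', t < r → d < c → t' < r → d' < c → (t, d) ≠ (t', d') →
      (∀ k ≤ r * c, t' < remHeight r c P k d' → t < remHeight r c P k d) →
      evacEntry (toListT r c P) t d < evacEntry (toListT r c P) t' d' := by
    intro t d t' d' ht hd ht' hd' hne h
    obtain ⟨k, hk, hv⟩ := exists_vacated hP hQ ht hd
    obtain ⟨k', hk', hv'⟩ := exists_vacated hP hQ ht' hd'
    rw [evacEntry_eq hP hQ hk hv, evacEntry_eq hP hQ hk' hv']
    have hle := le_of_lt_remHeight hP hQ hk'.le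
      (h k' hk'.le (lt_remHeight_of_vacated hP hQ hk' hv')) hv
    have : k ≠ k' := by
      rintro rfl
      exact hne (hv.symm.trans hv')
    omega
  refine ⟨?_, ?_, ?_, ?_, ?_⟩
  · intro i j hi hj
    refine key i j i (j + 1) hi (by omega) hi hj (by simp) fun k hk h => ?_
    exact h.trans_le ((stage_iterate hP hQ hk).1.anti (Nat.le_succ j))
  · intro i j hi hj
    exact key i j (i + 1) j (by omega) hj hi hj (by simp) fun k _ h => by omega
  · rintro ⟨i, j⟩ ⟨hi, hj⟩
    obtain ⟨k, hk, hv⟩ := exists_vacated hP hQ hi hj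
    rw [Set.mem_Icc]
    simp only [evacEntry_eq hP hQ hk hv]
    omega
  · rintro ⟨i, j⟩ ⟨hi, hj⟩ ⟨i', j'⟩ ⟨hi', hj'⟩ h
    obtain ⟨k, hk, hv⟩ := exists_vacated hP hQ hi hj
    obtain ⟨k', hk', hv'⟩ := exists_vacated hP hQ hi' hj'
    simp only [evacEntry_eq hP hQ hk hv, evacEntry_eq hP hQ hk' hv'] at h
    obtain rfl : k = k' := by omega
    exact hv.symm.trans hv'
  · rintro m ⟨h1, h2⟩
    have hk : r * c - m < r * c := by omega
    have hlt := lt_remHeight_of_vacated hP hQ hk rfl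
    refine ⟨vacated (delta^[r * c - m] (toListT r c P)),
      (stage_iterate hP hQ hk.le).1.lt_of_lt hlt, ?_⟩
    have h := evacEntry_eq hP hQ hk (Prod.mk.eta (p := vacated _)).symm
    simp only [h]
    omega

theorem promPerm_stack (hP : IsSYT r c P) (hQ : IsSYT r c Q) {k t d : ℕ} (hk : k < r * c)
    (hv : vacated (delta^[k] (toListT r c P)) = (t, d)) :
    promPerm (2 * r) c (stack r c P Q) r (k + 1) = Q (r - 1 - t) d + r * c := by
  have hS := (stage_iterate hP hQ hk.le).1
  have hD := slideData_iterate hP hQ hk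
  rw [hv] at hD
  obtain ⟨ht, hd⟩ := hS.lt_of_lt (lt_remHeight_of_vacated hP hQ hk hv)
  have hm := hQ.mem_Icc (show r - 1 - t < r by omega) hd
  have hs := hS.slideInto_eq hQ hD
  simp only at hs
  rw [promPerm, Nat.add_sub_cancel, hs, Nat.mod_eq_of_lt]
  · omega
  · rw [mul_assoc]
    omega

theorem pointsNE_promPerm_stack (hP : IsSYT r c P) (hQ : IsSYT r c Q) :
    pointsNE (r * c) (promPerm (2 * r) c (stack r c P Q) r) =
      diagFrom r c Q (evacEntry (toListT r c P)) (r - 1) 0 := by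
  apply Set.eq_of_subset_of_subset
  · rintro _ ⟨x, hx1, hxn, -, rfl⟩
    obtain ⟨k, rfl⟩ : ∃ k, x = k + 1 := ⟨x - 1, by omega⟩
    have hk : k < r * c := hxn
    obtain ⟨ht, hd⟩ := (stage_iterate hP hQ hk.le).1.lt_of_lt
      (lt_remHeight_of_vacated hP hQ hk rfl)
    refine ⟨_, _, _, by omega, ht, hd, Nat.zero_le _, Nat.sub_add_cancel (by omega), ?_⟩
    rw [promPerm_stack hP hQ hk rfl, evacEntry_eq hP hQ hk rfl, Prod.mk.injEq]
    omega
  · rintro _ ⟨s, t, d, hs, ht, hd, -, hst, rfl⟩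
    obtain ⟨k, hk, hv⟩ := exists_vacated hP hQ ht hd
    have hm := hQ.mem_Icc hs hd
    obtain rfl : s = r - 1 - t := by omega
    refine ⟨k + 1, by omega, hk, ?_, ?_⟩
    · rw [promPerm_stack hP hQ hk hv]
      omega
    · rw [promPerm_stack hP hQ hk hv, evacEntry_eq hP hQ hk hv, Prod.mk.injEq]
      omega

end Evacuation
/-- For `S = stack(P, Q)` with `P, Q ∈ SYT(r × c)`, `n = rc`, and
`ρ_r := prom_r(S) ∈ S_{2n}`, Viennot's construction with light shining northeast applied
to `𝒫^NE(ρ_r)` yields `𝒱(𝒫^NE(ρ_r), ↗) = (∂(P), Q)`. -/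
theorem viennot_NE_of_promotion (r c : ℕ) (P Q : ℕ → ℕ → ℕ)
    (hP : IsSYT r c P) (hQ : IsSYT r c Q) :
    ViennotNE (pointsNE (r * c) (promPerm (2 * r) c (stack r c P Q) r))
      (evacL (toListT r c P)) (toListT r c Q) := by
  rw [pointsNE_promPerm_stack hP hQ, evacL_toListT]
  exact viennotNE_diagFrom hQ (isSYT_evacEntry hP hQ)

end PromRS
end

section
/- Let σ ∈ S_n and let 𝒫 := {(σ(i), n+1−i) : 1 ≤ i ≤ n} ⊂ [n]×[n]. Then Viennot's construction with light shining southeast satisfies 𝒱(𝒫, ↘) = RS(σ), the pair of Robinson–Schensted insertion and recording tableaux of σ. -/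
namespace PromRS

/-! ## One row of the correspondence, refined to shadow lines

A point `(x, t)` records that `x` is inserted at time `t`. A row is refined to the list of its
shadow lines, each a list of points with the most recent one first, so that the entries of the row
are the first coordinates of the heads. -/

/-- Row insertion into a single row, together with the bumped entry. -/
def rowIns : List ℕ → ℕ → List ℕ × Option ℕ
  | [], x => ([x], none)
  | a :: r, x => if a < x then (a :: (rowIns r x).1, (rowIns r x).2) else (x :: r, some a)

/-- The row of the tableau in which `rowInsert` creates a new cell. -/
def rowInsertIdx : List (List ℕ) → ℕ → ℕ
  | [], _ => 0
  | r :: rs, x =>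
    match (rowIns r x).2 with
    | none => 0
    | some y => rowInsertIdx rs y + 1

def headPt (l : List (ℕ × ℕ)) : ℕ × ℕ := l.headD (0, 0)

def lastPt (l : List (ℕ × ℕ)) : ℕ × ℕ := l.getLastD (0, 0)

/-- Insertion of a point into a row of shadow lines, together with the bumped point. -/
def lineIns : List (List (ℕ × ℕ)) → ℕ × ℕ → List (List (ℕ × ℕ)) × Option (ℕ × ℕ)
  | [], p => ([[p]], none)
  | l :: r, p =>
    if (headPt l).1 < p.1 then (l :: (lineIns r p).1, (lineIns r p).2)
    else ((p :: l) :: r, some ((headPt l).1, p.2))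

/-- Insertion of a point into a tableau of shadow lines. -/
def tabIns : List (List (List (ℕ × ℕ))) → ℕ × ℕ → List (List (List (ℕ × ℕ)))
  | [], p => [[[p]]]
  | r :: rs, p =>
    match (lineIns r p).2 with
    | none => (lineIns r p).1 :: rs
    | some q => (lineIns r p).1 :: tabIns rs q

def headTab (X : List (List (List (ℕ × ℕ)))) : List (List ℕ) :=
  X.map fun r => r.map fun l => (headPt l).1

def lastTab (X : List (List (List (ℕ × ℕ)))) : List (List ℕ) :=
  X.map fun r => r.map fun l => (lastPt l).2

theorem rowIns_eq (r : List ℕ) (x : ℕ) :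
    rowIns r x = match r.dropWhile (fun y => decide (y < x)) with
      | [] => (r ++ [x], none)
      | y :: bs => (r.takeWhile (fun y => decide (y < x)) ++ x :: bs, some y) := by
  induction r with
  | nil => rfl
  | cons a r ih =>
    by_cases h : a < x
    · simp only [rowIns, h, if_true, List.dropWhile_cons, List.takeWhile_cons, decide_true, ih]
      cases List.dropWhile (fun y => decide (y < x)) r <;> simp
    · simp [rowIns, h]

theorem rowInsert_cons (r : List ℕ) (rs : List (List ℕ)) (x : ℕ) :
    rowInsert (r :: rs) x = match (rowIns r x).2 with
      | none => (rowIns r x).1 :: rs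
      | some y => (rowIns r x).1 :: rowInsert rs y := by
  rw [rowIns_eq, rowInsert]
  cases List.dropWhile (fun y => decide (y < x)) r <;> rfl

theorem rowIns_perm (r : List ℕ) (x : ℕ) :
    ((rowIns r x).1 ++ (rowIns r x).2.toList).Perm (x :: r) := by
  induction r with
  | nil => simp [rowIns]
  | cons a r ih =>
    by_cases h : a < x
    · simp only [rowIns, h, if_true, List.cons_append]
      exact (ih.cons a).trans (List.Perm.swap _ _ _)
    · simp only [rowIns, h, if_false, List.cons_append, Option.toList_some]
      exact (List.perm_append_singleton a r).cons x

theorem rowInsert_flatten_perm (P : List (List ℕ)) (x : ℕ) :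
    (rowInsert P x).flatten.Perm (x :: P.flatten) := by
  induction P generalizing x with
  | nil => simp [rowInsert]
  | cons r rs ih =>
    rw [rowInsert_cons]
    have h := rowIns_perm r x
    rcases ho : (rowIns r x).2 with _ | y
    · rw [ho] at h
      simp only [List.flatten_cons]
      simpa using h.append_right rs.flatten
    · rw [ho] at h
      simp only [List.flatten_cons]
      refine ((ih y).append_left _).trans ?_
      simpa using h.append_right rs.flatten

theorem length_rowIns (r : List ℕ) (x : ℕ) :
    (rowIns r x).1.length + (rowIns r x).2.toList.length = r.length + 1 := by
  simpa using (rowIns_perm r x).length_eq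

theorem rowInsertIdx_spec (P : List (List ℕ)) (x : ℕ) :
    rowInsertIdx P x < (rowInsert P x).length ∧
      (∀ i, i < rowInsertIdx P x →
        ((rowInsert P x).getD i []).length = (P.getD i []).length) ∧
      ((rowInsert P x).getD (rowInsertIdx P x) []).length ≠
        (P.getD (rowInsertIdx P x) []).length := by
  induction P generalizing x with
  | nil => simp [rowInsert, rowInsertIdx]
  | cons r rs ih =>
    rw [rowInsert_cons, rowInsertIdx]
    have h := length_rowIns r x
    rcases ho : (rowIns r x).2 with _ | y
    · rw [ho] at h
      simp at h
      simp [h]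
    · rw [ho] at h
      simp at h
      obtain ⟨h1, h2, h3⟩ := ih y
      refine ⟨by simpa using h1, ?_, by simpa using h3⟩
      rintro (_ | i) hi
      · simpa using h
      · simpa using h2 i (by simpa using hi)

theorem rowOfNewCell_rowInsert (P : List (List ℕ)) (x : ℕ) :
    rowOfNewCell P (rowInsert P x) = rowInsertIdx P x := by
  obtain ⟨h1, h2, h3⟩ := rowInsertIdx_spec P x
  have : (List.range (rowInsert P x).length).find? (fun i =>
      decide (((rowInsert P x).getD i []).length ≠ (P.getD i []).length)) =
      some (rowInsertIdx P x) := by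
    rw [List.find?_range_eq_some]
    refine ⟨by simpa using h3, by simpa using h1, fun j hj => ?_⟩
    simpa using h2 j hj
  rw [rowOfNewCell, this, Option.getD_some]

theorem placeInRow_flatten_perm (Q : List (List ℕ)) (k t : ℕ) :
    (placeInRow Q k t).flatten.Perm (t :: Q.flatten) := by
  induction Q generalizing k with
  | nil => simp [placeInRow]
  | cons q Q ih =>
    rcases k with _ | k
    · simp only [placeInRow, List.length_cons, Nat.zero_lt_succ, if_true, List.getD_cons_zero,
        List.set_cons_zero, List.flatten_cons, List.append_assoc, List.singleton_append]
      exact List.perm_middle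
    · have : placeInRow (q :: Q) (k + 1) t = q :: placeInRow Q k t := by
        simp only [placeInRow, List.length_cons, Nat.add_lt_add_iff_right]
        split_ifs <;> simp
      rw [this, List.flatten_cons]
      exact ((ih k).append_left q).trans List.perm_middle

theorem rowIns_map_headPt (r : List (List (ℕ × ℕ))) (p : ℕ × ℕ) :
    rowIns (r.map fun l => (headPt l).1) p.1 =
      ((lineIns r p).1.map fun l => (headPt l).1, (lineIns r p).2.map Prod.fst) := by
  induction r with
  | nil => simp [rowIns, lineIns, headPt]
  | cons l r ih =>
    simp only [List.map_cons, rowIns, lineIns, ih]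
    split_ifs <;> simp [headPt]

theorem lineIns_bump_snd (r : List (List (ℕ × ℕ))) (p q : ℕ × ℕ)
    (h : (lineIns r p).2 = some q) : q.2 = p.2 := by
  induction r with
  | nil => simp [lineIns] at h
  | cons l r ih =>
    simp only [lineIns] at h
    split_ifs at h
    · exact ih h
    · simp at h
      simp [← h]

theorem rowInsert_headTab (X : List (List (List (ℕ × ℕ)))) (p : ℕ × ℕ) :
    rowInsert (headTab X) p.1 = headTab (tabIns X p) := by
  induction X generalizing p with
  | nil => simp [headTab, rowInsert, tabIns, headPt]
  | cons r rs ih =>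
    have h : headTab (r :: rs) = (r.map fun l => (headPt l).1) :: headTab rs := rfl
    rw [h, rowInsert_cons, rowIns_map_headPt, tabIns]
    rcases ho : (lineIns r p).2 with _ | q
    · simp [headTab]
    · simp only [Option.map_some, ih q]
      simp [headTab]

theorem map_lastPt_lineIns (r : List (List (ℕ × ℕ))) (p : ℕ × ℕ) (hr : ∀ l ∈ r, l ≠ []) :
    ((lineIns r p).1.map fun l => (lastPt l).2) =
      (r.map fun l => (lastPt l).2) ++ if (lineIns r p).2 = none then [p.2] else [] := by
  induction r with
  | nil => simp [lineIns, lastPt]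
  | cons l r ih =>
    simp only [lineIns]
    split_ifs with h1 h2 h2
    · simp_all
    · simp_all
    · simp_all
    · rcases l with _ | ⟨a, l⟩
      · simp at hr
      · simp [lastPt]

theorem placeInRow_lastTab (X : List (List (List (ℕ × ℕ)))) (p : ℕ × ℕ)
    (hX : ∀ r ∈ X, ∀ l ∈ r, l ≠ []) :
    placeInRow (lastTab X) (rowInsertIdx (headTab X) p.1) p.2 = lastTab (tabIns X p) := by
  induction X generalizing p with
  | nil => simp [lastTab, headTab, placeInRow, rowInsertIdx, tabIns, lastPt]
  | cons r rs ih =>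
    have h : headTab (r :: rs) = (r.map fun l => (headPt l).1) :: headTab rs := rfl
    have h' : ∀ r rs, lastTab (r :: rs) = (r.map fun l => (lastPt l).2) :: lastTab rs :=
      fun _ _ => rfl
    have hl := map_lastPt_lineIns r p (hX r (by simp))
    rw [h, rowInsertIdx, rowIns_map_headPt, tabIns, h']
    rcases ho : (lineIns r p).2 with _ | q
    · simp [placeInRow, h', hl, ho]
    · have hq := ih q fun r hr => hX r (by simp [hr])
      rw [lineIns_bump_snd r p q ho] at hq
      simp only [h', hl, ho, ← hq, placeInRow, Option.map_some, List.length_cons,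
        Nat.add_lt_add_iff_right]
      split_ifs <;> simp_all

/-! ## Invariants -/

/-- The skeleton of a shadow line. -/
def lineSk : List (ℕ × ℕ) → List (ℕ × ℕ)
  | a :: b :: l => (b.1, a.2) :: lineSk (b :: l)
  | _ => []

def rowSk (r : List (List (ℕ × ℕ))) : List (ℕ × ℕ) := r.flatMap lineSk

/-- Every point of `l'` lies in the shadow of a point of `l`. -/
def ShadowedBy (l l' : List (ℕ × ℕ)) : Prop := ∀ p ∈ l', ∃ q ∈ l, q.1 ≤ p.1 ∧ q.2 ≤ p.2

/-- `r` is the list of the shadow lines of its points. -/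
structure IsShadowRow (r : List (List (ℕ × ℕ))) : Prop where
  ne_nil : ∀ l ∈ r, l ≠ []
  antichain : ∀ l ∈ r, l.Pairwise fun a b => a.1 < b.1 ∧ b.2 < a.2
  nodup : (r.flatten.map Prod.fst).Nodup
  chain : r.IsChain ShadowedBy

/-- Each row of `X` consists of the shadow lines of the skeleton of the preceding row, where the
first row has the point set `S`. -/
def IsShadowTab : Set (ℕ × ℕ) → List (List (List (ℕ × ℕ))) → Prop
  | S, [] => S = ∅
  | S, r :: rs => IsShadowRow r ∧ S = {p | p ∈ r.flatten} ∧ IsShadowTab {p | p ∈ rowSk r} rs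

theorem map_fst_lineSk (l : List (ℕ × ℕ)) : (lineSk l).map Prod.fst = l.tail.map Prod.fst := by
  induction l with
  | nil => rfl
  | cons a l ih =>
    rcases l with _ | ⟨b, l⟩
    · rfl
    · simpa [lineSk] using ih

theorem exists_snd_eq_of_mem_lineSk {l : List (ℕ × ℕ)} {s : ℕ × ℕ} (hs : s ∈ lineSk l) :
    ∃ q ∈ l, q.2 = s.2 := by
  induction l with
  | nil => simp [lineSk] at hs
  | cons a l ih =>
    rcases l with _ | ⟨b, l⟩
    · simp [lineSk] at hs
    · simp only [lineSk, List.mem_cons] at hs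
      rcases hs with rfl | hs
      · exact ⟨a, by simp⟩
      · obtain ⟨q, hq, h⟩ := ih hs
        exact ⟨q, List.mem_cons_of_mem _ hq, h⟩

theorem lineIns_flatten_perm (r : List (List (ℕ × ℕ))) (p : ℕ × ℕ) :
    (lineIns r p).1.flatten.Perm (p :: r.flatten) := by
  induction r with
  | nil => simp [lineIns]
  | cons l r ih =>
    simp only [lineIns]
    split_ifs
    · simp only [List.flatten_cons]
      exact (ih.append_left l).trans List.perm_middle
    · simp

theorem mem_rowSk_lineIns (r : List (List (ℕ × ℕ))) (p : ℕ × ℕ) (hr : ∀ l ∈ r, l ≠ [])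
    (s : ℕ × ℕ) : s ∈ rowSk (lineIns r p).1 ↔ (lineIns r p).2 = some s ∨ s ∈ rowSk r := by
  induction r with
  | nil => simp [lineIns, rowSk, lineSk]
  | cons l r ih =>
    simp only [lineIns]
    have ih := ih fun l hl => hr l (by simp [hl])
    simp only [rowSk] at ih ⊢
    split_ifs
    · simp only [List.flatMap_cons, List.mem_append, ih]
      tauto
    · rcases l with _ | ⟨a, l⟩
      · simp at hr
      · simp [lineSk, headPt, eq_comm]

theorem lineIns_chain (l₀ : List (ℕ × ℕ)) (r : List (List (ℕ × ℕ))) (p : ℕ × ℕ)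
    (hr : ∀ l ∈ r, l ≠ []) (hp : ∀ q ∈ r.flatten, q.2 < p.2)
    (h : (l₀ :: r).IsChain ShadowedBy) (h₀ : ∃ q ∈ l₀, q.1 ≤ p.1 ∧ q.2 ≤ p.2) :
    (l₀ :: (lineIns r p).1).IsChain ShadowedBy := by
  induction r generalizing l₀ with
  | nil => simpa [lineIns, ShadowedBy] using h₀
  | cons l r ih =>
    simp only [lineIns]
    rw [List.isChain_cons_cons] at h
    split_ifs with hlt
    · rw [List.isChain_cons_cons]
      refine ⟨h.1, ih l (fun l hl => hr l (by simp [hl])) (fun q hq => hp q (by simp_all)) h.2 ?_⟩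
      rcases l with _ | ⟨a, l⟩
      · simp at hr
      · exact ⟨a, by simp, hlt.le, (hp a (by simp)).le⟩
    · rw [List.isChain_cons_cons]
      constructor
      · intro q hq
        rcases List.mem_cons.1 hq with rfl | hq
        · exact h₀
        · exact h.1 q hq
      · rcases r with _ | ⟨l', r⟩
        · simp
        · rw [List.isChain_cons_cons] at h ⊢
          refine ⟨fun q hq => ?_, h.2.2⟩
          obtain ⟨q', hq', h'⟩ := h.2.1 q hq
          exact ⟨q', by simp [hq'], h'⟩

theorem lineIns_antichain (r : List (List (ℕ × ℕ))) (p : ℕ × ℕ)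
    (hr : ∀ l ∈ r, l ≠ []) (ha : ∀ l ∈ r, l.Pairwise fun a b => a.1 < b.1 ∧ b.2 < a.2)
    (hp : ∀ q ∈ r.flatten, q.2 < p.2) (hp' : ∀ q ∈ r.flatten, q.1 ≠ p.1) :
    ∀ l ∈ (lineIns r p).1, l ≠ [] ∧ l.Pairwise fun a b => a.1 < b.1 ∧ b.2 < a.2 := by
  induction r with
  | nil => simp [lineIns]
  | cons l r ih =>
    simp only [lineIns]
    split_ifs with hlt
    · intro l' hl'
      rcases List.mem_cons.1 hl' with rfl | hl'
      · exact ⟨hr _ (by simp), ha _ (by simp)⟩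
      · exact ih (fun l hl => hr l (by simp [hl])) (fun l hl => ha l (by simp [hl]))
          (fun q hq => hp q (by simp_all)) (fun q hq => hp' q (by simp_all)) l' hl'
    · intro l' hl'
      rcases List.mem_cons.1 hl' with rfl | hl'
      · refine ⟨by simp, List.pairwise_cons.2 ⟨fun b hb => ?_, ha l (by simp)⟩⟩
        refine ⟨?_, hp b (by simp [hb])⟩
        have hl := ha l (by simp)
        rcases l with _ | ⟨a, l⟩
        · simp at hb
        · have h1 := hp' a (by simp)
          simp only [headPt, List.headD_cons] at hlt
          rcases List.mem_cons.1 hb with rfl | hb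
          · omega
          · have := ((List.pairwise_cons.1 hl).1 b hb).1
            omega
      · exact ⟨hr l' (by simp [hl']), ha l' (by simp [hl'])⟩

theorem IsShadowRow.lineIns {r : List (List (ℕ × ℕ))} (hr : IsShadowRow r) {p : ℕ × ℕ}
    (hp : ∀ q ∈ r.flatten, q.2 < p.2) (hp' : ∀ q ∈ r.flatten, q.1 ≠ p.1) :
    IsShadowRow (lineIns r p).1 := by
  have h := lineIns_antichain r p hr.ne_nil hr.antichain hp hp'
  refine ⟨fun l hl => (h l hl).1, fun l hl => (h l hl).2, ?_, ?_⟩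
  · rw [((lineIns_flatten_perm r p).map Prod.fst).nodup_iff, List.map_cons, List.nodup_cons]
    refine ⟨fun hm => ?_, hr.nodup⟩
    obtain ⟨q, hq, h⟩ := List.mem_map.1 hm
    exact hp' q hq h
  · have h₀ : ([(0, 0)] :: r).IsChain ShadowedBy := by
      rcases r with _ | ⟨l, r⟩
      · simp
      · exact List.isChain_cons_cons.2 ⟨by simp [ShadowedBy], hr.chain⟩
    exact (lineIns_chain _ r p hr.ne_nil hp h₀ ⟨_, List.mem_singleton_self _, by simp⟩).tail

theorem rowSk_snd_lt {r : List (List (ℕ × ℕ))} {t : ℕ} (hp : ∀ q ∈ r.flatten, q.2 < t) :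
    ∀ s ∈ rowSk r, s.2 < t := by
  intro s hs
  obtain ⟨l, hl, hs⟩ := List.mem_flatMap.1 hs
  obtain ⟨q, hq, h⟩ := exists_snd_eq_of_mem_lineSk hs
  exact h ▸ hp q (List.mem_flatten.2 ⟨l, hl, hq⟩)

theorem mem_map_fst_flatten_of_mem_rowSk {r : List (List (ℕ × ℕ))} {s : ℕ × ℕ}
    (hs : s ∈ rowSk r) : s.1 ∈ r.flatten.map Prod.fst := by
  obtain ⟨l, hl, hs⟩ := List.mem_flatMap.1 hs
  have := List.mem_map_of_mem (f := Prod.fst) hs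
  rw [map_fst_lineSk] at this
  obtain ⟨q, hq, h⟩ := List.mem_map.1 this
  exact List.mem_map.2 ⟨q, List.mem_flatten.2 ⟨l, hl, List.mem_of_mem_tail hq⟩, h⟩

theorem lineIns_bump_fst {r : List (List (ℕ × ℕ))} {p q : ℕ × ℕ} (hr : ∀ l ∈ r, l ≠ [])
    (hn : (r.flatten.map Prod.fst).Nodup) (h : (lineIns r p).2 = some q) :
    q.1 ∈ r.flatten.map Prod.fst ∧ ∀ s ∈ rowSk r, s.1 ≠ q.1 := by
  induction r with
  | nil => simp [lineIns] at h
  | cons l r ih =>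
    rw [List.flatten_cons, List.map_append] at hn ⊢
    obtain ⟨n1, n2, n3⟩ := List.nodup_append.1 hn
    have hsk : ∀ s ∈ rowSk (l :: r), s ∈ lineSk l ∨ s ∈ rowSk r := by
      simp [rowSk]
    have hfst : ∀ s ∈ lineSk l, s.1 ∈ l.tail.map Prod.fst := fun s hs => by
      rw [← map_fst_lineSk]
      exact List.mem_map_of_mem hs
    simp only [PromRS.lineIns] at h
    split_ifs at h
    · obtain ⟨i1, i2⟩ := ih (fun l hl => hr l (by simp [hl])) n2 h
      refine ⟨List.mem_append_right _ i1, fun s hs => ?_⟩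
      rcases hsk s hs with hs | hs
      · refine n3 _ ?_ _ i1
        have := hfst s hs
        rw [List.map_tail] at this
        exact List.mem_of_mem_tail this
      · exact i2 s hs
    · rcases l with _ | ⟨a, l⟩
      · simp at hr
      · simp [headPt] at h
        subst h
        refine ⟨by simp, fun s hs => ?_⟩
        rcases hsk s hs with hs | hs
        · have := hfst s hs
          intro e
          simp only [List.tail_cons, List.map_cons, List.nodup_cons] at this n1
          exact n1.1 (e ▸ this)
        · exact (n3 _ (by simp) _ (mem_map_fst_flatten_of_mem_rowSk hs)).symm

theorem IsShadowTab.tabIns {X : List (List (List (ℕ × ℕ)))} {S : Set (ℕ × ℕ)}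
    (hX : IsShadowTab S X) {p : ℕ × ℕ} (hp : ∀ q ∈ S, q.2 < p.2) (hp' : ∀ q ∈ S, q.1 ≠ p.1) :
    IsShadowTab (insert p S) (tabIns X p) := by
  induction X generalizing S p with
  | nil =>
    simp only [IsShadowTab] at hX
    subst hX
    refine ⟨⟨by simp, by simp, by simp, by simp⟩, by ext; simp, ?_⟩
    simp [IsShadowTab, rowSk, lineSk]
  | cons r rs ih =>
    obtain ⟨hr, rfl, hrs⟩ := hX
    have hr' := hr.lineIns hp hp'
    have hS : insert p {q | q ∈ r.flatten} = {q | q ∈ (PromRS.lineIns r p).1.flatten} := by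
      ext q
      rw [Set.mem_ofPred_eq, (lineIns_flatten_perm r p).mem_iff]
      simp
    rw [PromRS.tabIns]
    rcases ho : (PromRS.lineIns r p).2 with _ | q
    · refine ⟨hr', hS, ?_⟩
      convert hrs using 2
      ext s
      simp [mem_rowSk_lineIns r p hr.ne_nil, ho]
    · refine ⟨hr', hS, ?_⟩
      have hq := lineIns_bump_snd r p q ho
      convert ih (p := q) hrs (fun s hs => hq ▸ rowSk_snd_lt hp s hs)
        (lineIns_bump_fst hr.ne_nil hr.nodup ho).2 using 1
      ext s
      simp [mem_rowSk_lineIns r p hr.ne_nil, ho, eq_comm]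

theorem IsShadowTab.isShadowRow {X : List (List (List (ℕ × ℕ)))} {S : Set (ℕ × ℕ)}
    (hX : IsShadowTab S X) : ∀ r ∈ X, IsShadowRow r := by
  induction X generalizing S with
  | nil => simp
  | cons r rs ih =>
    obtain ⟨hr, -, hrs⟩ := hX
    exact List.forall_mem_cons.2 ⟨hr, ih hrs⟩

/-! ## Geometry of shadow lines -/

/-- The position in the plane of a value inserted at a given time. -/
def toPlane (N : ℤ) (p : ℕ × ℕ) : ℤ × ℤ := (p.1, N - p.2)

def planeSet (N : ℤ) (l : List (ℕ × ℕ)) : Set (ℤ × ℤ) := {z | ∃ p ∈ l, toPlane N p = z}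

theorem dirSE_toPlane {N : ℤ} {p q : ℕ × ℕ} :
    dirSE (toPlane N p) (toPlane N q) ↔ p.1 ≤ q.1 ∧ p.2 ≤ q.2 := by
  simp only [dirSE, toPlane]
  omega

theorem toPlane_injective (N : ℤ) : Function.Injective (toPlane N) := by
  rintro ⟨a, b⟩ ⟨c, d⟩ h
  simpa [toPlane] using h

theorem minimalsUnder_empty (d : ℤ × ℤ → ℤ × ℤ → Prop) : minimalsUnder d ∅ = ∅ := by
  simp [minimalsUnder]

theorem shadowRest_succ' (d : ℤ × ℤ → ℤ × ℤ → Prop) (P : Set (ℤ × ℤ)) (j : ℕ) :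
    shadowRest d P (j + 1) = shadowRest d (P \ minimalsUnder d P) j := by
  induction j with
  | zero => rfl
  | succ j ih => rw [shadowRest, ih, shadowRest]

theorem shadowRest_empty (d : ℤ × ℤ → ℤ × ℤ → Prop) (j : ℕ) : shadowRest d ∅ j = ∅ := by
  induction j with
  | zero => rfl
  | succ j ih => rw [shadowRest, ih, Set.empty_sdiff]

theorem exists_le_of_isChain {l : List (ℕ × ℕ)} {r : List (List (ℕ × ℕ))}
    (h : (l :: r).IsChain ShadowedBy) : ∀ p ∈ r.flatten, ∃ q ∈ l, q.1 ≤ p.1 ∧ q.2 ≤ p.2 := by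
  induction r generalizing l with
  | nil => simp
  | cons l' r ih =>
    rw [List.isChain_cons_cons] at h
    intro p hp
    rw [List.flatten_cons, List.mem_append] at hp
    rcases hp with hp | hp
    · exact h.1 p hp
    · obtain ⟨q, hq, h1, h2⟩ := ih h.2 p hp
      obtain ⟨q', hq', h3, h4⟩ := h.1 q hq
      exact ⟨q', hq', h3.trans h1, h4.trans h2⟩

theorem eq_of_pairwise {l : List (ℕ × ℕ)} (h : l.Pairwise fun a b => a.1 < b.1 ∧ b.2 < a.2)
    {p q : ℕ × ℕ} (hp : p ∈ l) (hq : q ∈ l) (h1 : p.1 ≤ q.1) (h2 : p.2 ≤ q.2) : p = q := by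
  induction l with
  | nil => simp at hp
  | cons a l ih =>
    obtain ⟨ha, hl⟩ := List.pairwise_cons.1 h
    rcases List.mem_cons.1 hp with rfl | hp' <;> rcases List.mem_cons.1 hq with rfl | hq'
    · rfl
    · have := ha q hq'
      omega
    · have := ha p hp'
      omega
    · exact ih hl hp' hq'

theorem IsShadowRow.tail {l : List (ℕ × ℕ)} {r : List (List (ℕ × ℕ))}
    (h : IsShadowRow (l :: r)) : IsShadowRow r := by
  refine ⟨fun l hl => h.ne_nil l (by simp [hl]), fun l hl => h.antichain l (by simp [hl]), ?_,
    h.chain.tail⟩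
  have := h.nodup
  rw [List.flatten_cons, List.map_append] at this
  exact (List.nodup_append.1 this).2.1

theorem IsShadowRow.disjoint {l : List (ℕ × ℕ)} {r : List (List (ℕ × ℕ))}
    (h : IsShadowRow (l :: r)) {p : ℕ × ℕ} (hp : p ∈ l) (hp' : p ∈ r.flatten) : False := by
  have := h.nodup
  rw [List.flatten_cons, List.map_append] at this
  exact (List.nodup_append.1 this).2.2 _ (List.mem_map_of_mem hp) _ (List.mem_map_of_mem hp') rfl

theorem minimalsUnder_planeSet {N : ℤ} {l : List (ℕ × ℕ)} {r : List (List (ℕ × ℕ))}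
    (h : IsShadowRow (l :: r)) :
    minimalsUnder dirSE (planeSet N (l :: r).flatten) = planeSet N l := by
  have ha := h.antichain l (by simp)
  have hc := exists_le_of_isChain h.chain
  ext z
  constructor
  · rintro ⟨⟨p, hp, rfl⟩, hmin⟩
    rw [List.flatten_cons, List.mem_append] at hp
    rcases hp with hp | hp
    · exact ⟨p, hp, rfl⟩
    · obtain ⟨q, hq, hqp⟩ := hc p hp
      exact ⟨q, hq, hmin _ ⟨q, by simp [hq], rfl⟩ (dirSE_toPlane.2 hqp)⟩
  · rintro ⟨p, hp, rfl⟩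
    refine ⟨⟨p, by simp [hp], rfl⟩, ?_⟩
    rintro _ ⟨q, hq, rfl⟩ hqp
    rw [dirSE_toPlane] at hqp
    rw [List.flatten_cons, List.mem_append] at hq
    rcases hq with hq | hq
    · rw [eq_of_pairwise ha hq hp hqp.1 hqp.2]
    · obtain ⟨q', hq', h1, h2⟩ := hc q hq
      have := eq_of_pairwise ha hq' hp (h1.trans hqp.1) (h2.trans hqp.2)
      subst this
      have : q = q' := Prod.ext (le_antisymm hqp.1 h1) (le_antisymm hqp.2 h2)
      rw [this]

theorem planeSet_diff {N : ℤ} {l : List (ℕ × ℕ)} {r : List (List (ℕ × ℕ))}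
    (h : IsShadowRow (l :: r)) :
    planeSet N (l :: r).flatten \ planeSet N l = planeSet N r.flatten := by
  ext z
  constructor
  · rintro ⟨⟨p, hp, rfl⟩, hn⟩
    rw [List.flatten_cons, List.mem_append] at hp
    exact ⟨p, hp.resolve_left fun hp => hn ⟨p, hp, rfl⟩, rfl⟩
  · rintro ⟨p, hp, rfl⟩
    refine ⟨⟨p, by simp_all, rfl⟩, ?_⟩
    rintro ⟨q, hq, e⟩
    rw [toPlane_injective N e] at hq
    exact h.disjoint hq hp

theorem shadowLine_planeSet {N : ℤ} {r : List (List (ℕ × ℕ))} (h : IsShadowRow r) (j : ℕ) :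
    shadowLine dirSE (planeSet N r.flatten) (j + 1) = planeSet N (r.getD j []) := by
  rw [shadowLine, Nat.add_sub_cancel]
  induction r generalizing j with
  | nil => simp [planeSet, shadowRest_empty, minimalsUnder_empty]
  | cons l r ih =>
    rcases j with _ | j
    · simpa [shadowRest] using minimalsUnder_planeSet h
    · rw [shadowRest_succ', minimalsUnder_planeSet h, planeSet_diff h, ih h.tail]
      simp

theorem covered_twice_iff {N : ℤ} {l : List (ℕ × ℕ)}
    (h : l.Pairwise fun a b => a.1 < b.1 ∧ b.2 < a.2) (z : ℤ × ℤ) :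
    (∃ p ∈ planeSet N l, ∃ q ∈ planeSet N l, p ≠ q ∧ dirSE p z ∧ dirSE q z) ↔
      ∃ s ∈ lineSk l, dirSE (toPlane N s) z := by
  induction l with
  | nil => simp [planeSet, lineSk]
  | cons a l ih =>
    obtain ⟨ha, hl⟩ := List.pairwise_cons.1 h
    rcases l with _ | ⟨b, l⟩
    · simp [planeSet, lineSk]
    · have ih := ih hl
      have hb := ha b (by simp)
      have hle : ∀ q ∈ b :: l, b.1 ≤ q.1 := by
        intro q hq
        rcases List.mem_cons.1 hq with rfl | hq
        · rfl
        · exact ((List.pairwise_cons.1 hl).1 q hq).1.le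
      simp only [lineSk, List.mem_cons (b := (b.1, a.2)), exists_eq_or_imp, ← ih]
      constructor
      · rintro ⟨_, ⟨p, hp, rfl⟩, _, ⟨q, hq, rfl⟩, hne, hpz, hqz⟩
        rcases List.mem_cons.1 hp with rfl | hp' <;> rcases List.mem_cons.1 hq with rfl | hq'
        · exact absurd rfl hne
        · left
          have := hle q hq'
          simp only [dirSE, toPlane] at *
          omega
        · left
          have := hle p hp'
          simp only [dirSE, toPlane] at *
          omega
        · exact Or.inr ⟨_, ⟨p, hp', rfl⟩, _, ⟨q, hq', rfl⟩, hne, hpz, hqz⟩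
      · rintro (hs | ⟨_, ⟨p, hp, rfl⟩, _, ⟨q, hq, rfl⟩, hh⟩)
        · refine ⟨_, ⟨a, by simp, rfl⟩, _, ⟨b, by simp, rfl⟩, fun e => ?_, ?_, ?_⟩
          · rw [toPlane_injective N e] at hb
            omega
          all_goals
            simp only [dirSE, toPlane] at *
            omega
        · exact ⟨_, ⟨p, List.mem_cons_of_mem _ hp, rfl⟩, _, ⟨q, List.mem_cons_of_mem _ hq, rfl⟩, hh⟩

theorem lineSk_pairwise {l : List (ℕ × ℕ)} (h : l.Pairwise fun a b => a.1 < b.1 ∧ b.2 < a.2) :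
    (lineSk l).Pairwise fun a b => a.1 < b.1 ∧ b.2 < a.2 := by
  induction l with
  | nil => simp [lineSk]
  | cons a l ih =>
    obtain ⟨ha, hl⟩ := List.pairwise_cons.1 h
    rcases l with _ | ⟨b, l⟩
    · simp [lineSk]
    · refine List.pairwise_cons.2 ⟨fun s hs => ⟨?_, ?_⟩, ih hl⟩
      · have := List.mem_map_of_mem (f := Prod.fst) hs
        rw [map_fst_lineSk] at this
        obtain ⟨q, hq, e⟩ := List.mem_map.1 this
        exact e ▸ ((List.pairwise_cons.1 hl).1 q hq).1
      · obtain ⟨q, hq, e⟩ := exists_snd_eq_of_mem_lineSk hs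
        exact e ▸ (ha q hq).2

theorem lineSkeleton_planeSet {N : ℤ} {l : List (ℕ × ℕ)}
    (h : l.Pairwise fun a b => a.1 < b.1 ∧ b.2 < a.2) :
    lineSkeleton dirSE (planeSet N l) = planeSet N (lineSk l) := by
  have hs := lineSk_pairwise h
  simp only [lineSkeleton, covered_twice_iff h]
  ext z
  constructor
  · rintro ⟨⟨s, hs, hsz⟩, hmin⟩
    exact ⟨s, hs, hmin _ ⟨s, hs, le_rfl, le_rfl⟩ hsz⟩
  · rintro ⟨s, hs', rfl⟩
    refine ⟨⟨s, hs', le_rfl, le_rfl⟩, ?_⟩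
    rintro q ⟨s', hs'', h1⟩ h2
    have h3 : dirSE (toPlane N s') (toPlane N s) := ⟨h1.1.trans h2.1, h2.2.trans h1.2⟩
    rw [dirSE_toPlane] at h3
    rw [eq_of_pairwise hs hs'' hs' h3.1 h3.2] at h1
    exact Prod.ext (le_antisymm h2.1 h1.1) (le_antisymm h1.2 h2.2)

theorem pairwise_getD {r : List (List (ℕ × ℕ))} (h : IsShadowRow r) (j : ℕ) :
    (r.getD j []).Pairwise fun a b => a.1 < b.1 ∧ b.2 < a.2 := by
  by_cases hj : j < r.length
  · rw [List.getD_eq_getElem _ _ hj]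
    exact h.antichain _ (List.getElem_mem hj)
  · rw [List.getD_eq_default _ _ (not_lt.1 hj)]
    exact List.Pairwise.nil

theorem exists_getD_iff {α : Type*} (r : List (List α)) (φ : List α → Prop) (h : ¬ φ []) :
    (∃ j, φ (r.getD j [])) ↔ ∃ l ∈ r, φ l := by
  constructor
  · rintro ⟨j, hj⟩
    by_cases hlt : j < r.length
    · rw [List.getD_eq_getElem _ _ hlt] at hj
      exact ⟨_, List.getElem_mem hlt, hj⟩
    · rw [List.getD_eq_default _ _ (not_lt.1 hlt)] at hj
      exact absurd hj h
  · rintro ⟨l, hl, hφ⟩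
    obtain ⟨j, hj, rfl⟩ := List.mem_iff_getElem.1 hl
    exact ⟨j, by rwa [List.getD_eq_getElem _ _ hj]⟩

theorem skeleton_planeSet {N : ℤ} {r : List (List (ℕ × ℕ))} (h : IsShadowRow r) :
    skeleton dirSE (planeSet N r.flatten) = planeSet N (rowSk r) := by
  ext z
  simp only [skeleton, shadowLine_planeSet h, lineSkeleton_planeSet (pairwise_getD h _),
    Set.mem_iUnion]
  rw [exists_getD_iff r (fun l => z ∈ planeSet N (lineSk l)) (by simp [planeSet, lineSk])]
  simp only [planeSet, rowSk, Set.mem_ofPred_eq, List.mem_flatMap]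
  tauto

theorem isShadowRow_nil : IsShadowRow [] := ⟨by simp, by simp, by simp, by simp⟩

theorem skeleton_empty : skeleton dirSE ∅ = ∅ := by
  simpa [planeSet, rowSk] using skeleton_planeSet (N := 0) isShadowRow_nil

theorem IsShadowTab.isShadowRow_getD {X : List (List (List (ℕ × ℕ)))} {S : Set (ℕ × ℕ)}
    (hX : IsShadowTab S X) (i : ℕ) : IsShadowRow (X.getD i []) := by
  by_cases hi : i < X.length
  · rw [List.getD_eq_getElem _ _ hi]
    exact hX.isShadowRow _ (List.getElem_mem hi)
  · rw [List.getD_eq_default _ _ (not_lt.1 hi)]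
    exact isShadowRow_nil

theorem skeletonIter_image {N : ℤ} {X : List (List (List (ℕ × ℕ)))} {S : Set (ℕ × ℕ)}
    (hX : IsShadowTab S X) (i : ℕ) :
    skeletonIter dirSE (toPlane N '' S) i = planeSet N (X.getD i []).flatten := by
  rw [skeletonIter]
  induction X generalizing S i with
  | nil =>
    simp only [IsShadowTab] at hX
    rw [hX, Set.image_empty, Function.iterate_fixed skeleton_empty]
    simp [planeSet]
  | cons r rs ih =>
    obtain ⟨hr, rfl, hrs⟩ := hX
    rcases i with _ | i
    · rfl
    · rw [Function.iterate_succ_apply]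
      change (skeleton dirSE)^[i] (skeleton dirSE (planeSet N r.flatten)) = _
      rw [skeleton_planeSet hr]
      exact ih hrs i

theorem isMinFst_planeSet {N : ℤ} {l : List (ℕ × ℕ)} (hl : l ≠ [])
    (h : l.Pairwise fun a b => a.1 < b.1 ∧ b.2 < a.2) (v : ℤ) :
    IsMinFst (planeSet N l) v ↔ ((headPt l).1 : ℤ) = v := by
  obtain ⟨a, l, rfl⟩ := List.exists_cons_of_ne_nil hl
  have hle : ∀ q ∈ a :: l, a.1 ≤ q.1 := by
    intro q hq
    rcases List.mem_cons.1 hq with rfl | hq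
    · rfl
    · exact ((List.pairwise_cons.1 h).1 q hq).1.le
  have ha : a ∈ a :: l := by simp
  simp only [headPt, List.headD_cons]
  constructor
  · rintro ⟨⟨_, ⟨p, hp, rfl⟩, rfl⟩, hmin⟩
    have h1 := hmin _ ⟨a, ha, rfl⟩
    have h2 := hle p hp
    simp only [toPlane] at *
    omega
  · rintro rfl
    refine ⟨⟨_, ⟨a, ha, rfl⟩, rfl⟩, ?_⟩
    rintro _ ⟨p, hp, rfl⟩
    have h2 := hle p hp
    simp only [toPlane]
    omega

theorem isMaxSnd_planeSet {N : ℤ} {l : List (ℕ × ℕ)} (hl : l ≠ [])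
    (h : l.Pairwise fun a b => a.1 < b.1 ∧ b.2 < a.2) (v : ℤ) :
    IsMaxSnd (planeSet N l) v ↔ N - (lastPt l).2 = v := by
  obtain ⟨l, a, rfl⟩ := (List.eq_nil_or_concat' l).resolve_left hl
  have hle : ∀ q ∈ l ++ [a], a.2 ≤ q.2 := by
    intro q hq
    rcases List.mem_append.1 hq with hq | hq
    · exact ((List.pairwise_append.1 h).2.2 q hq a (by simp)).2.le
    · rw [List.mem_singleton.1 hq]
  have ha : a ∈ l ++ [a] := by simp
  have hlast : lastPt (l ++ [a]) = a := by simp [lastPt]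
  rw [hlast]
  constructor
  · rintro ⟨⟨_, ⟨p, hp, rfl⟩, rfl⟩, hmin⟩
    have h1 := hmin _ ⟨a, ha, rfl⟩
    have h2 := hle p hp
    simp only [toPlane] at *
    omega
  · rintro rfl
    refine ⟨⟨_, ⟨a, ha, rfl⟩, rfl⟩, ?_⟩
    rintro _ ⟨p, hp, rfl⟩
    have h2 := hle p hp
    simp only [toPlane]
    omega

theorem mem_exitSet_iff {N : ℤ} {X : List (List (List (ℕ × ℕ)))} {S : Set (ℕ × ℕ)}
    (hX : IsShadowTab S X) {spec : Set (ℤ × ℤ) → ℤ → Prop} {f : List (ℕ × ℕ) → ℤ}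
    (hspec : ∀ l v, l ≠ [] → (l.Pairwise fun a b => a.1 < b.1 ∧ b.2 < a.2) →
      (spec (planeSet N l) v ↔ f l = v))
    (hempty : ∀ v, ¬ spec ∅ v) (i : ℕ) (v : ℤ) :
    v ∈ exitSet spec dirSE (toPlane N '' S) i ↔ ∃ l ∈ X.getD i [], f l = v := by
  have hr := hX.isShadowRow_getD i
  simp only [exitSet, skeletonIter_image hX, shadowLine_planeSet hr, Set.mem_ofPred_eq]
  rw [exists_getD_iff _ (fun l => spec (planeSet N l) v) (by simpa [planeSet] using hempty v)]
  refine exists_congr fun l => and_congr_right fun hl => ?_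
  exact hspec l v (hr.ne_nil l hl) (hr.antichain l hl)

/-! ## Reading off the tableaux -/

theorem findIdx_contains_eq {T : List (List ℕ)} (hT : T.flatten.Nodup) {i m : ℕ}
    (hm : m ∈ T.getD i []) : (T.findIdx fun row => row.contains m) = i := by
  have hi : i < T.length := by
    by_contra hi
    rw [List.getD_eq_default _ _ (not_lt.1 hi)] at hm
    simp at hm
  rw [List.getD_eq_getElem _ _ hi] at hm
  rw [List.findIdx_eq hi]
  refine ⟨by simpa using hm, fun j hj => ?_⟩
  have hd := List.pairwise_iff_getElem.1 (List.nodup_flatten.1 hT).2 j i (hj.trans hi) hi hj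
  simpa using fun h => hd h hm

theorem readsWord_of_exitSet {spec : Set (ℤ × ℤ) → ℤ → Prop} {lt : ℤ → ℤ → Prop}
    {d : ℤ × ℤ → ℤ × ℤ → Prop} {P : Set (ℤ × ℤ)} {T : List (List ℕ)} {n : ℕ} (g : ℕ → ℤ)
    (hT : T.flatten.Perm (List.range' 1 n)) (hg : Function.Injective g)
    (hlt : ∀ a b, a < b → lt (g a) (g b))
    (hexit : ∀ i v, v ∈ exitSet spec d P i ↔ ∃ m ∈ T.getD i [], g m = v) :
    ReadsWord spec lt d P T := by
  have hlen : T.flatten.length = n := by simpa using hT.length_eq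
  have hmem : ∀ m, m ∈ T.flatten ↔ 1 ≤ m ∧ m ≤ n := by
    intro m
    rw [hT.mem_iff, List.mem_range'_1]
    omega
  refine ⟨fun a => g (a + 1), fun a b hab => hlt _ _ (by simpa using hab), ?_, ?_⟩
  · ext v
    simp only [Set.mem_range, Set.mem_iUnion, hexit]
    rw [exists_getD_iff T (fun l => ∃ m ∈ l, g m = v) (by simp)]
    constructor
    · rintro ⟨a, rfl⟩
      have ha := a.2
      obtain ⟨l, hl, h⟩ := List.mem_flatten.1 ((hmem (a + 1)).2 ⟨by omega, by omega⟩)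
      exact ⟨l, hl, _, h, rfl⟩
    · rintro ⟨l, hl, m, hm, rfl⟩
      have := (hmem m).1 (List.mem_flatten.2 ⟨l, hl, hm⟩)
      exact ⟨⟨m - 1, by omega⟩, by simp [Nat.sub_add_cancel this.1]⟩
  · intro m i hm
    obtain ⟨k, hk, e⟩ := (hexit i _).1 hm
    rw [hg e] at hk
    rw [findIdx_contains_eq (hT.nodup_iff.2 List.nodup_range') hk]

/-- The tableau of shadow lines after the first `m` insertions. -/
def shadowTab (σ : ℕ → ℕ) (m : ℕ) : List (List (List (ℕ × ℕ))) :=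
  (List.range m).foldl (fun X i => tabIns X (σ (i + 1), i + 1)) []

theorem isShadowTab_shadowTab {n : ℕ} {σ : ℕ → ℕ} (hσ : Set.InjOn σ (Set.Icc 1 n)) {m : ℕ}
    (hm : m ≤ n) :
    IsShadowTab {p | ∃ i, 1 ≤ i ∧ i ≤ m ∧ p = (σ i, i)} (shadowTab σ m) := by
  induction m with
  | zero =>
    simp only [shadowTab, List.range_zero, List.foldl_nil, IsShadowTab]
    ext p
    simp only [Set.mem_ofPred_eq, Set.mem_empty_iff_false, iff_false]
    rintro ⟨i, h1, h2, -⟩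
    omega
  | succ m ih =>
    have hins := (ih (by omega)).tabIns (p := (σ (m + 1), m + 1))
      (by rintro _ ⟨i, h1, h2, rfl⟩; simp; omega)
      (by
        rintro _ ⟨i, h1, h2, rfl⟩ e
        have := hσ ⟨h1, by omega⟩ ⟨by omega, hm⟩ e
        omega)
    have hstep : shadowTab σ (m + 1) = tabIns (shadowTab σ m) (σ (m + 1), m + 1) := by
      simp [shadowTab, List.range_succ]
    rw [hstep]
    convert hins using 1
    ext p
    simp only [Set.mem_ofPred_eq, Set.mem_insert_iff]
    constructor
    · rintro ⟨i, h1, h2, rfl⟩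
      rcases Nat.lt_or_ge m i with h | h
      · obtain rfl : i = m + 1 := by omega
        exact Or.inl rfl
      · exact Or.inr ⟨i, h1, h, rfl⟩
    · rintro (rfl | ⟨i, h1, h2, rfl⟩)
      · exact ⟨m + 1, by omega, le_rfl, rfl⟩
      · exact ⟨i, h1, by omega, rfl⟩

theorem RS_eq_shadowTab {n : ℕ} {σ : ℕ → ℕ} (hσ : Set.InjOn σ (Set.Icc 1 n)) :
    RS ((List.range n).map fun i => σ (i + 1)) =
        (headTab (shadowTab σ n), lastTab (shadowTab σ n)) ∧
      (headTab (shadowTab σ n)).flatten.Perm ((List.range n).map fun i => σ (i + 1)) ∧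
      (lastTab (shadowTab σ n)).flatten.Perm (List.range' 1 n) := by
  suffices h : ∀ m ≤ n, (List.range m).foldl
      (fun PQ i =>
        let P' := rowInsert PQ.1 (((List.range n).map fun i => σ (i + 1)).getD i 0)
        (P', placeInRow PQ.2 (rowOfNewCell PQ.1 P') (i + 1)))
      ([], []) = (headTab (shadowTab σ m), lastTab (shadowTab σ m)) ∧
      (headTab (shadowTab σ m)).flatten.Perm ((List.range m).map fun i => σ (i + 1)) ∧
      (lastTab (shadowTab σ m)).flatten.Perm (List.range' 1 m) by
    simpa [RS] using h n le_rfl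
  intro m hm
  induction m with
  | zero => simp [shadowTab, headTab, lastTab]
  | succ m ih =>
    obtain ⟨ih, hP, hQ⟩ := ih (by omega)
    have hX := isShadowTab_shadowTab hσ (m := m) (by omega)
    have hstep : shadowTab σ (m + 1) = tabIns (shadowTab σ m) (σ (m + 1), m + 1) := by
      simp [shadowTab, List.range_succ]
    have hw : ((List.range n).map fun i => σ (i + 1)).getD m 0 = σ (m + 1) := by
      simp [List.getD, show m < n by omega]
    have hh := rowInsert_headTab (shadowTab σ m) (σ (m + 1), m + 1)
    have hl := placeInRow_lastTab (shadowTab σ m) (σ (m + 1), m + 1)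
      fun r hr => (hX.isShadowRow r hr).ne_nil
    refine ⟨?_, ?_, ?_⟩
    · rw [List.range_succ, List.foldl_append, ih]
      simp only [List.foldl_cons, List.foldl_nil, hw, rowOfNewCell_rowInsert, hstep, ← hh, ← hl]
    · rw [hstep, ← hh, List.range_succ, List.map_append]
      refine (rowInsert_flatten_perm _ _).trans ((hP.cons _).trans ?_)
      exact (List.perm_append_singleton _ _).symm
    · rw [hstep, ← hl, List.range'_1_concat]
      refine (placeInRow_flatten_perm _ _ _).trans ((hQ.cons _).trans ?_)
      rw [Nat.add_comm]
      exact (List.perm_append_singleton _ _).symm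

theorem map_perm_range' {n : ℕ} {σ : ℕ → ℕ} (hσ : Set.BijOn σ (Set.Icc 1 n) (Set.Icc 1 n)) :
    ((List.range n).map fun i => σ (i + 1)).Perm (List.range' 1 n) := by
  rw [List.perm_ext_iff_of_nodup _ List.nodup_range']
  · intro a
    rw [List.mem_range'_1, List.mem_map]
    constructor
    · rintro ⟨i, hi, rfl⟩
      have := hσ.mapsTo (x := i + 1) ⟨by omega, by simpa using hi⟩
      simp only [Set.mem_Icc] at this
      omega
    · intro ha
      obtain ⟨i, hi, rfl⟩ := hσ.surjOn (show a ∈ Set.Icc 1 n from ⟨ha.1, by omega⟩)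
      simp only [Set.mem_Icc] at hi
      exact ⟨i - 1, by simp; omega, by rw [Nat.sub_add_cancel hi.1]⟩
  · refine List.Nodup.map_on (fun a ha b hb e => ?_) List.nodup_range
    simp only [List.mem_range] at ha hb
    have := hσ.injOn ⟨by omega, by omega⟩ ⟨by omega, by omega⟩ e
    omega

theorem getD_map_map {α β : Type*} (X : List (List α)) (f : α → β) (i : ℕ) :
    (X.map fun r => r.map f).getD i [] = (X.getD i []).map f := by
  simp only [List.getD_eq_getElem?_getD, List.getElem?_map]
  cases X[i]? <;> rfl

/-- For `σ ∈ S_n` and the point set `𝒫 = {(σ(i), n+1-i) : 1 ≤ i ≤ n}`,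
Viennot's construction with light shining southeast computes the Robinson–Schensted pair:
`𝒱(𝒫, ↘) = RS(σ)`. -/
theorem viennot_SE_eq_RS (n : ℕ) (σ : ℕ → ℕ)
    (hσ : Set.BijOn σ (Set.Icc 1 n) (Set.Icc 1 n)) :
    ViennotSE {p : ℤ × ℤ | ∃ i : ℕ, 1 ≤ i ∧ i ≤ n ∧ p = ((σ i : ℤ), (n : ℤ) + 1 - i)}
      (RS ((List.range n).map fun i => σ (i + 1))).1
      (RS ((List.range n).map fun i => σ (i + 1))).2 := by
  have hX := isShadowTab_shadowTab hσ.injOn le_rfl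
  obtain ⟨hRS, hP, hQ⟩ := RS_eq_shadowTab hσ.injOn
  have hset : {p : ℤ × ℤ | ∃ i : ℕ, 1 ≤ i ∧ i ≤ n ∧ p = ((σ i : ℤ), (n : ℤ) + 1 - i)} =
      toPlane (n + 1) '' {p | ∃ i, 1 ≤ i ∧ i ≤ n ∧ p = (σ i, i)} := by
    ext z
    constructor
    · rintro ⟨i, h1, h2, rfl⟩
      exact ⟨_, ⟨i, h1, h2, rfl⟩, rfl⟩
    · rintro ⟨_, ⟨i, h1, h2, rfl⟩, rfl⟩
      exact ⟨i, h1, h2, rfl⟩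
  rw [hRS, hset]
  constructor
  · refine readsWord_of_exitSet (fun m => (m : ℤ)) (hP.trans (map_perm_range' hσ))
      Nat.cast_injective (fun a b h => by simpa using h) fun i v => ?_
    rw [mem_exitSet_iff hX (fun l v hl h => isMinFst_planeSet hl h v) (by simp [IsMinFst]),
      headTab, getD_map_map]
    simp
  · refine readsWord_of_exitSet (fun m => (n : ℤ) + 1 - m) hQ
      (fun a b h => by simpa using h) (fun a b h => by simpa using h) fun i v => ?_
    rw [mem_exitSet_iff hX (fun l v hl h => isMaxSnd_planeSet hl h v) (by simp [IsMaxSnd]),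
      lastTab, getD_map_map]
    simp

end PromRS
end
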